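/- arXiv:2311.01397 — 2 statements merged into one kernel-verified Lean document; each statement's English description precedes it below -/
import Mathlib

section
/- Let M be a matroid on a finite ground set E with no loops and no coloops. Then, as functions ℝ^E → ℤ, the indicator function of the relative interior of the base polytope P(M) equals the sum, over all chains C in the lattice of cyclic flats Z(M) that contain both the minimum 0_Z and the maximum 1_Z of Z(M), of (−1)^{c(M)−c(S_C)} · λ_C times the indicator function of the relative interior of P(S_C), where λ_C = −μ(C, 1̂) is computed via the Möbius function μ of the cyclic chain lattice of M, and c(N) denotes the number of connected components of a matroid N. -/
open scoped Classical

namespace GPoly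

/-- A step of a Delannoy path: east `+(1,0)`, north `+(0,1)` or diagonal `+(1,1)`. -/
inductive DStep : Type
  | east : DStep
  | north : DStep
  | diag : DStep
  deriving DecidableEq

/-- Horizontal displacement of a step. -/
def DStep.dx : DStep → ℕ
  | .east => 1
  | .north => 0
  | .diag => 1

/-- Vertical displacement of a step. -/
def DStep.dy : DStep → ℕ
  | .east => 0
  | .north => 1
  | .diag => 1

/-- Position reached after the first `k` steps of `P`, starting at the point `s`. -/
def pathPos (s : ℕ × ℕ) (P : List DStep) (k : ℕ) : ℕ × ℕ :=
  (s.1 + ((P.take k).map DStep.dx).sum, s.2 + ((P.take k).map DStep.dy).sum)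

/-- The Gale order: `U ≤ B` iff the increasing enumerations satisfy `u_ℓ ≤ b_ℓ`. -/
def galeLe {α : Type*} [LinearOrder α] (U B : Finset α) : Prop :=
  List.Forall₂ (· ≤ ·) (U.sort (· ≤ ·)) (B.sort (· ≤ ·))

/-- Bases of the Schubert matroid `SM(U)` of rank `r` on `[n] = {1, …, n}`:
all `r`-subsets `B` of `[n]` with `U ≤ B` in the Gale order. -/
noncomputable def schubertBases (n r : ℕ) (U : Finset ℕ) : Finset (Finset ℕ) :=
  (Finset.Icc 1 n).powerset.filter fun B => B.card = r ∧ galeLe U B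

/-- The point `p` lies weakly below the lattice path `path(U)`. -/
def belowPath (U : Finset ℕ) (p : ℕ × ℕ) : Prop :=
  p.2 ≤ (U ∩ Finset.Icc 1 (p.1 + p.2)).card

/-- `path(U)` traverses the vertical unit segment from `(x, y)` to `(x, y+1)`
(by its north step number `x + y + 1`). -/
def uVertSeg (U : Finset ℕ) (x y : ℕ) : Prop :=
  x + y + 1 ∈ U ∧ (U ∩ Finset.Icc 1 (x + y + 1)).card = y + 1

/-- A Delannoy path associated to `SM(U)`: starts at `(1,1)`, ends at `(n-r, r)` and
stays weakly below `path(U)`. -/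
def IsDelannoy (n r : ℕ) (U : Finset ℕ) (P : List DStep) : Prop :=
  pathPos (1, 1) P P.length = (n - r, r) ∧
    ∀ k ≤ P.length, belowPath U (pathPos (1, 1) P k)

/-- Admissible Delannoy path associated to `SM(U)`. -/
def IsAdmissible (n r : ℕ) (U : Finset ℕ) (P : List DStep) : Prop :=
  IsDelannoy n r U P ∧
    ∀ (k : ℕ) (h : k < P.length),
      (P.get ⟨k, h⟩ = DStep.north →
        pathPos (1, 1) P (k + 1) = (n - r, r) ∨
          ¬ uVertSeg U (pathPos (1, 1) P k).1 (pathPos (1, 1) P k).2) ∧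
      (P.get ⟨k, h⟩ = DStep.diag →
        belowPath U ((pathPos (1, 1) P k).1, (pathPos (1, 1) P k).2 + 1) ∧
          ¬ uVertSeg U (pathPos (1, 1) P k).1 (pathPos (1, 1) P k).2)

/-- Number of diagonal steps of a path. -/
def diagCount (P : List DStep) : ℕ := (P.filter (· = DStep.diag)).length

/-- The set of indices (0-based) of the diagonal steps of `P`. -/
def diagIndices (P : List DStep) : Finset ℕ :=
  (Finset.range P.length).filter fun k => P.getD k DStep.east = DStep.diag

/-- Replace a diagonal step by a north step followed by an east step. -/
def expandNE : DStep → List DStep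
  | DStep.diag => [DStep.north, DStep.east]
  | s => [s]

/-- Replace a diagonal step by an east step followed by a north step. -/
def expandEN : DStep → List DStep
  | DStep.diag => [DStep.east, DStep.north]
  | s => [s]

/-- The full lattice path of `B_P`: an east step, a north step, then the steps of `P`
with each diagonal step replaced by a north step immediately followed by an east step. -/
def fullPath (P : List DStep) : List DStep :=
  DStep.east :: DStep.north :: (P.map expandNE).flatten

/-- The subset of `[n]` whose `path` is the given (diagonal-free) list of steps:
the set of (1-based) positions of the north steps. -/
def northSet (L : List DStep) : Finset ℕ :=
  ((Finset.range L.length).filter fun k => L.getD k DStep.east = DStep.north).image (· + 1)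

/-- The basis `B_P` associated to a Delannoy path `P`. -/
def delannoyBasis (P : List DStep) : Finset ℕ := northSet (fullPath P)

/-! ### Matroid notions for a family of bases -/

/-- `S` is independent for the basis family `ℬ`: it is contained in some basis. -/
def famIndep (ℬ : Finset (Finset ℕ)) (S : Finset ℕ) : Prop := ∃ B ∈ ℬ, S ⊆ B

/-- `C` is a circuit for the basis family `ℬ`: a minimal dependent set. -/
def famCircuit (ℬ : Finset (Finset ℕ)) (C : Finset ℕ) : Prop :=
  ¬ famIndep ℬ C ∧ ∀ C' ⊂ C, famIndep ℬ C'

/-- The dual basis family on the ground set `E`: complements of bases. -/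
noncomputable def famDual (E : Finset ℕ) (ℬ : Finset (Finset ℕ)) : Finset (Finset ℕ) :=
  ℬ.image fun B => E \ B

/-- `e ∉ B` is externally active: `e` is the smallest element of the unique circuit
contained in `B ∪ {e}`. -/
def ExtActive (E : Finset ℕ) (ℬ : Finset (Finset ℕ)) (B : Finset ℕ) (e : ℕ) : Prop :=
  e ∈ E ∧ e ∉ B ∧
    ∃ C, C ⊆ insert e B ∧ famCircuit ℬ C ∧ e ∈ C ∧ ∀ x ∈ C, e ≤ x

/-- `i ∈ B` is internally active: `i` is the smallest element of the unique cocircuit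
contained in `(E ∖ B) ∪ {i}`. -/
def IntActive (E : Finset ℕ) (ℬ : Finset (Finset ℕ)) (B : Finset ℕ) (i : ℕ) : Prop :=
  i ∈ B ∧
    ∃ C, C ⊆ insert i (E \ B) ∧ famCircuit (famDual E ℬ) C ∧ i ∈ C ∧ ∀ x ∈ C, i ≤ x

/-- External activity `e(B)`. -/
noncomputable def extAct (E : Finset ℕ) (ℬ : Finset (Finset ℕ)) (B : Finset ℕ) : ℕ :=
  (E.filter (ExtActive E ℬ B)).card

/-- Internal activity `i(B)`. -/
noncomputable def intAct (E : Finset ℕ) (ℬ : Finset (Finset ℕ)) (B : Finset ℕ) : ℕ :=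
  (E.filter (IntActive E ℬ B)).card

/-- The statistic `α(B)`: the number of `i ∈ B` such that `B' = (B ∖ {i}) ∪ {i+1}`
is a basis with `e(B') = e(B)` and `i(B') = i(B)`. -/
noncomputable def alphaStat (E : Finset ℕ) (ℬ : Finset (Finset ℕ)) (B : Finset ℕ) : ℕ :=
  (B.filter fun i =>
    insert (i + 1) (B.erase i) ∈ ℬ ∧
      extAct E ℬ (insert (i + 1) (B.erase i)) = extAct E ℬ B ∧
      intAct E ℬ (insert (i + 1) (B.erase i)) = intAct E ℬ B).card

/-- The rank function determined by a family of bases. -/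
noncomputable def famRank (ℬ : Finset (Finset ℕ)) (A : Finset ℕ) : ℕ :=
  ℬ.sup fun B => (A ∩ B).card

/-- The β-invariant: `β(M) = (−1)^{rk(E)} Σ_{A ⊆ E} (−1)^{|A|} rk(A)`. -/
noncomputable def betaInv (E : Finset ℕ) (ℬ : Finset (Finset ℕ)) : ℤ :=
  (-1) ^ famRank ℬ E * ∑ A ∈ E.powerset, (-1) ^ A.card * (famRank ℬ A : ℤ)

/-- `ℬ` is the collection of bases of a matroid with ground set `E`:
it is a nonempty family of subsets of `E` satisfying the basis exchange property. -/
def IsBasisFamily (E : Finset ℕ) (ℬ : Finset (Finset ℕ)) : Prop :=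
  ℬ.Nonempty ∧ (∀ B ∈ ℬ, B ⊆ E) ∧
    ∀ B₁ ∈ ℬ, ∀ B₂ ∈ ℬ, ∀ x ∈ B₁ \ B₂, ∃ y ∈ B₂ \ B₁, insert y (B₁.erase x) ∈ ℬ

/-- Two elements lie in a common component: they are equal or in a common circuit. -/
def connRel (ℬ : Finset (Finset ℕ)) (e f : ℕ) : Prop :=
  e = f ∨ ∃ C, famCircuit ℬ C ∧ e ∈ C ∧ f ∈ C

/-- The number of connected components of the matroid with bases `ℬ` on `E`. -/
noncomputable def numComponents (E : Finset ℕ) (ℬ : Finset (Finset ℕ)) : ℕ :=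
  Set.ncard {S : Set ℕ | ∃ e ∈ E, S = {f | f ∈ E ∧ Relation.EqvGen (connRel ℬ) e f}}

/-- The matroid with bases `ℬ` on ground set `E` is connected. -/
def IsConnectedFam (E : Finset ℕ) (ℬ : Finset (Finset ℕ)) : Prop :=
  E.Nonempty ∧ ∀ e ∈ E, ∀ f ∈ E, Relation.EqvGen (connRel ℬ) e f

/-- Series-parallel matroid: isomorphic to `U_{0,1}` or `U_{1,1}`
(a single loop or a single coloop), or connected with β-invariant `1`. -/
def IsSeriesParallel (E : Finset ℕ) (ℬ : Finset (Finset ℕ)) : Prop :=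
  (E.card = 1 ∧ (ℬ = {∅} ∨ ℬ = {E})) ∨ (IsConnectedFam E ℬ ∧ betaInv E ℬ = 1)

/-- The bases of the restriction of the matroid with bases `ℬ` to the set `F`:
the maximal intersections of bases with `F`. -/
noncomputable def famRestrict (ℬ : Finset (Finset ℕ)) (F : Finset ℕ) : Finset (Finset ℕ) :=
  (ℬ.image (· ∩ F)).filter fun S => ∀ T ∈ ℬ.image (· ∩ F), S ⊆ T → S = T

/-- The matroid with bases `ℬ` on `E` is a direct sum of series-parallel matroids. -/
def IsDirectSumOfSeriesParallel (E : Finset ℕ) (ℬ : Finset (Finset ℕ)) : Prop :=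
  ∃ parts : Finset (Finset ℕ),
    (↑parts : Set (Finset ℕ)).PairwiseDisjoint id ∧
    parts.sup id = E ∧
    (∀ S ∈ parts, IsSeriesParallel S (famRestrict ℬ S)) ∧
    ℬ = E.powerset.filter fun B => ∀ S ∈ parts, B ∩ S ∈ famRestrict ℬ S

/-! ### Base polytopes -/

/-- The indicator vector of `B ⊆ E`, as a point of `ℝ^E`. -/
noncomputable def basisVector (E : Finset ℕ) (B : Finset ℕ) : ↑E → ℝ :=
  fun e => if (e : ℕ) ∈ B then 1 else 0

/-- The base polytope of the matroid with bases `ℬ` on `E`: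
the convex hull in `ℝ^E` of the indicator vectors of the bases. -/
noncomputable def basePolytope (E : Finset ℕ) (ℬ : Finset (Finset ℕ)) : Set (↑E → ℝ) :=
  convexHull ℝ (basisVector E '' (↑ℬ : Set (Finset ℕ)))

/-- The indicator function `ℝ^E → ℤ` of the base polytope. -/
noncomputable def polyInd (E : Finset ℕ) (ℬ : Finset (Finset ℕ)) : (↑E → ℝ) → ℤ :=
  fun x => if x ∈ basePolytope E ℬ then 1 else 0

/-- The indicator function `ℝ^E → ℤ` of the relative interior of the base polytope. -/
noncomputable def relintInd (E : Finset ℕ) (ℬ : Finset (Finset ℕ)) : (↑E → ℝ) → ℤ :=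
  fun x => if x ∈ intrinsicInterior ℝ (basePolytope E ℬ) then 1 else 0

/-! ### Cyclic flats and the cyclic chain lattice -/

/-- `F` is a flat of the matroid with bases `ℬ` on `E`. -/
def IsFlat (E : Finset ℕ) (ℬ : Finset (Finset ℕ)) (F : Finset ℕ) : Prop :=
  F ⊆ E ∧ ∀ e ∈ E, famRank ℬ (insert e F) = famRank ℬ F → e ∈ F

/-- `F` is a cyclic flat: a flat whose restriction has no coloops. -/
def IsCyclicFlat (E : Finset ℕ) (ℬ : Finset (Finset ℕ)) (F : Finset ℕ) : Prop :=
  IsFlat E ℬ F ∧ ∀ e ∈ F, ¬ (∀ S ∈ famRestrict ℬ F, e ∈ S)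

/-- The set of cyclic flats. -/
noncomputable def cyclicFlats (E : Finset ℕ) (ℬ : Finset (Finset ℕ)) : Finset (Finset ℕ) :=
  E.powerset.filter (IsCyclicFlat E ℬ)

/-- A chain of cyclic flats containing the minimum and maximum of the lattice of
cyclic flats; these are the elements (other than the top `1̂`) of the cyclic
chain lattice. -/
def IsCyclicChain (E : Finset ℕ) (ℬ : Finset (Finset ℕ)) (C : Finset (Finset ℕ)) : Prop :=
  ↑C ⊆ (cyclicFlats E ℬ : Set (Finset ℕ)) ∧ IsChain (· ⊆ ·) (↑C : Set (Finset ℕ)) ∧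
    (∃ F ∈ C, ∀ G ∈ cyclicFlats E ℬ, F ⊆ G) ∧
    (∃ F ∈ C, ∀ G ∈ cyclicFlats E ℬ, G ⊆ F)

/-- The set of chains of cyclic flats containing the minimum and the maximum. -/
noncomputable def cyclicChains (E : Finset ℕ) (ℬ : Finset (Finset ℕ)) :
    Finset (Finset (Finset ℕ)) :=
  (cyclicFlats E ℬ).powerset.filter (IsCyclicChain E ℬ)

/-- The rank function `A ↦ min_{Z ∈ C} (rk_M(Z) + |A ∖ Z|)` associated to a chain `C`. -/
noncomputable def chainRank (ℬ : Finset (Finset ℕ)) (C : Finset (Finset ℕ))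
    (A : Finset ℕ) : ℕ :=
  if h : C.Nonempty then C.inf' h fun Z => famRank ℬ Z + (A \ Z).card else A.card

/-- The bases of the matroid on `E` with rank function `rk`:
the subsets `B ⊆ E` with `rk B = |B| = rk E`. -/
noncomputable def basesOfRank (E : Finset ℕ) (rk : Finset ℕ → ℕ) : Finset (Finset ℕ) :=
  E.powerset.filter fun B => rk B = B.card ∧ rk B = rk E

/-- The bases of the Schubert matroid `S_C` associated to a chain `C` of cyclic flats. -/
noncomputable def chainSchubert (E : Finset ℕ) (ℬ : Finset (Finset ℕ))
    (C : Finset (Finset ℕ)) : Finset (Finset ℕ) :=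
  basesOfRank E (chainRank ℬ C)

/-- The point reached by `path(S)` after `k` steps. -/
def pathPoint (S : Finset ℕ) (k : ℕ) : ℕ × ℕ :=
  (k - (S ∩ Finset.Icc 1 k).card, (S ∩ Finset.Icc 1 k).card)



/-- Rank function axioms. -/
structure RankFn (r : Finset ℕ → ℕ) : Prop where
  empty : r ∅ = 0
  mono : ∀ {A B : Finset ℕ}, A ⊆ B → r A ≤ r B
  unit : ∀ (e : ℕ) (A : Finset ℕ), r (insert e A) ≤ r A + 1
  submod : ∀ A B : Finset ℕ, r (A ∪ B) + r (A ∩ B) ≤ r A + r B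

namespace RankFn
variable {r : Finset ℕ → ℕ}

theorem union_le (hr : RankFn r) (A S : Finset ℕ) : r (A ∪ S) ≤ r A + S.card := by
  induction S using Finset.induction_on with
  | empty => simp
  | insert a S ha ih =>
    rw [Finset.union_insert, Finset.card_insert_of_notMem ha]
    have := hr.unit a (A ∪ S)
    omega

theorem le_add_card_sdiff (hr : RankFn r) (A B : Finset ℕ) : r B ≤ r A + (B \ A).card := by
  refine (hr.mono ?_).trans (hr.union_le A (B \ A))
  intro x hx; simp [hx]

theorem le_card (hr : RankFn r) (A : Finset ℕ) : r A ≤ A.card := by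
  have := hr.union_le ∅ A
  simpa [hr.empty] using this

theorem indep_subset (hr : RankFn r) {A B : Finset ℕ} (h : A ⊆ B) (hB : r B = B.card) : r A = A.card := by
  have h1 := hr.le_add_card_sdiff A B
  have h2 := Finset.card_sdiff_add_card_eq_card h
  have h3 := hr.le_card A
  omega

theorem eq_of_insert (hr : RankFn r) {J : Finset ℕ} (S : Finset ℕ) (h : ∀ e ∈ S, r (insert e J) ≤ r J) :
    r (J ∪ S) = r J := by
  induction S using Finset.induction_on with
  | empty => simp
  | insert a S ha ih =>
    have ih := ih (fun e he => h e (by simp [he]))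
    have h1 := hr.submod (J ∪ S) (insert a J)
    have h2 : J ∪ S ∪ insert a J = J ∪ insert a S := by ext; simp; tauto
    have h3 : r J ≤ r ((J ∪ S) ∩ insert a J) := hr.mono (by intro x hx; simp [hx])
    have h4 : r J ≤ r (J ∪ insert a S) := hr.mono (by intro x hx; simp [hx])
    have h5 := h a (by simp)
    rw [h2] at h1
    omega

theorem exists_extend (hr : RankFn r) {I A : Finset ℕ} (hIA : I ⊆ A) (hI : r I = I.card) :
    ∃ J, I ⊆ J ∧ J ⊆ A ∧ r J = J.card ∧ r J = r A := by
  obtain ⟨J, hJ, hmax⟩ := Finset.exists_max_image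
    (A.powerset.filter fun J => I ⊆ J ∧ r J = J.card) Finset.card ⟨I, by simp [hIA, hI]⟩
  simp only [Finset.mem_filter, Finset.mem_powerset] at hJ hmax
  obtain ⟨hJA, hIJ, hJr⟩ := hJ
  refine ⟨J, hIJ, hJA, hJr, ?_⟩
  have := hr.eq_of_insert (J := J) A (by
    intro e he
    by_cases heJ : e ∈ J
    · rw [Finset.insert_eq_of_mem heJ]
    by_contra hlt
    have h1 := hr.unit e J
    have h2 := Finset.card_insert_of_notMem heJ
    have := hmax (insert e J) ⟨Finset.insert_subset he hJA,
      hIJ.trans (Finset.subset_insert _ _), by omega⟩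
    omega)
  rw [Finset.union_eq_right.2 hJA] at this
  exact this.symm

theorem famIndep_iff (hr : RankFn r) {E I : Finset ℕ} :
    famIndep (basesOfRank E r) I ↔ I ⊆ E ∧ r I = I.card := by
  constructor
  · rintro ⟨B, hB, hIB⟩
    simp only [basesOfRank, Finset.mem_filter, Finset.mem_powerset] at hB
    exact ⟨hIB.trans hB.1, hr.indep_subset hIB hB.2.1⟩
  · rintro ⟨hIE, hI⟩
    obtain ⟨J, h1, h2, h3, h4⟩ := hr.exists_extend hIE hI
    exact ⟨J, by simp only [basesOfRank, Finset.mem_filter, Finset.mem_powerset]; exact ⟨h2, h3, h4⟩, h1⟩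

theorem exists_circuit (hr : RankFn r) {E D : Finset ℕ} (hD : ¬ famIndep (basesOfRank E r) D) :
    ∃ C ⊆ D, famCircuit (basesOfRank E r) C := by
  induction D using Finset.strongInduction with
  | H D ih =>
    by_cases h : ∀ C' ⊂ D, famIndep (basesOfRank E r) C'
    · exact ⟨D, subset_rfl, hD, h⟩
    · push Not at h
      obtain ⟨C', h1, h2⟩ := h
      obtain ⟨C, h3, h4⟩ := ih C' h1 h2
      exact ⟨C, h3.trans h1.1, h4⟩

/-- a set closed under circuits is a separator -/
theorem separator_of_closed (hr : RankFn r) {E K : Finset ℕ} (hK : K ⊆ E)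
    (h : ∀ C, famCircuit (basesOfRank E r) C → ∀ a ∈ C, a ∈ K → C ⊆ K) :
    r K + r (E \ K) = r E := by
  obtain ⟨I, -, hIK, hI, hIr⟩ := hr.exists_extend (Finset.empty_subset K) (by simp [hr.empty])
  obtain ⟨J, -, hJK, hJ, hJr⟩ := hr.exists_extend (Finset.empty_subset (E \ K))
    (by simp [hr.empty])
  have hle : r E ≤ r K + r (E \ K) := by
    have := hr.submod K (E \ K)
    rw [Finset.union_sdiff_of_subset hK] at this
    omega
  have hdis : Disjoint I J := by
    refine Finset.disjoint_left.2 fun a ha hb => ?_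
    have := hJK hb
    simp at this
    exact this.2 (hIK ha)
  have hE : I ∪ J ⊆ E := Finset.union_subset (hIK.trans hK) (hJK.trans Finset.sdiff_subset)
  by_cases hind : famIndep (basesOfRank E r) (I ∪ J)
  · have h1 := (hr.famIndep_iff.1 hind).2
    rw [Finset.card_union_of_disjoint hdis] at h1
    have := hr.mono hE
    omega
  · exfalso
    obtain ⟨C, hC, hcirc⟩ := hr.exists_circuit hind
    apply hcirc.1
    by_cases hm : ∃ a ∈ C, a ∈ K
    · obtain ⟨a, ha, haK⟩ := hm
      have hCK := h C hcirc a ha haK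
      have : C ⊆ I := by
        intro x hx
        rcases Finset.mem_union.1 (hC hx) with h1 | h1
        · exact h1
        · have := hJK h1
          simp at this
          exact absurd (hCK hx) this.2
      exact hr.famIndep_iff.2 ⟨hC.trans hE, hr.indep_subset this hI⟩
    · push Not at hm
      have : C ⊆ J := by
        intro x hx
        rcases Finset.mem_union.1 (hC hx) with h1 | h1
        · exact absurd (hIK h1) (hm x hx)
        · exact h1
      exact hr.famIndep_iff.2 ⟨hC.trans hE, hr.indep_subset this hJ⟩

theorem closed_of_separator (hr : RankFn r) {E A : Finset ℕ} (hA : A ⊆ E) (h : r A + r (E \ A) = r E)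
    {C : Finset ℕ} (hC : famCircuit (basesOfRank E r) C) {a : ℕ} (ha : a ∈ C) (haA : a ∈ A) :
    C ⊆ A := by
  by_contra hcon
  obtain ⟨b, hb, hbA⟩ := Finset.not_subset.1 hcon
  apply hC.1
  have h1 := hr.famIndep_iff.1 (hC.2 (C ∩ A) ⟨Finset.inter_subset_left, fun h => hbA (by
    have := h hb; simp at this; exact this.2)⟩)
  have h2 := hr.famIndep_iff.1 (hC.2 (C \ A) ⟨Finset.sdiff_subset, fun h => by
    have := h ha; simp at this; exact this.2 haA⟩)
  have hCE : C ⊆ E := by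
    rw [← Finset.sdiff_union_inter C A]
    exact Finset.union_subset h2.1 h1.1
  refine hr.famIndep_iff.2 ⟨hCE, ?_⟩
  have h3 := hr.submod C A
  have h4 := hr.submod (C ∪ A) (E \ A)
  have e1 : (C ∪ A) ∪ (E \ A) = E := by
    ext x; simp only [Finset.mem_union, Finset.mem_sdiff]
    constructor
    · rintro ((h | h) | h)
      exacts [hCE h, hA h, h.1]
    · tauto
  have e2 : (C ∪ A) ∩ (E \ A) = C \ A := by
    ext x; simp only [Finset.mem_union, Finset.mem_sdiff, Finset.mem_inter]
    have := @hCE x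
    tauto
  rw [e1, e2] at h4
  have h5 := hr.le_card C
  have h6 := Finset.card_sdiff_add_card_inter C A
  omega

end RankFn

/-! famRank is a rank function -/
section fam
variable {E : Finset ℕ} {ℬ : Finset (Finset ℕ)}

theorem card_eq_of_bases (hM : IsBasisFamily E ℬ) (B₁ B₂ : Finset ℕ) (h1 : B₁ ∈ ℬ) (h2 : B₂ ∈ ℬ) : B₁.card = B₂.card := by
  induction hn : (B₁ \ B₂).card using Nat.strong_induction_on generalizing B₁ with
  | _ n ih =>
    by_cases he : (B₁ \ B₂).Nonempty
    · obtain ⟨x, hx⟩ := he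
      obtain ⟨y, hy, hB⟩ := hM.2.2 B₁ h1 B₂ h2 x hx
      simp only [Finset.mem_sdiff] at hx hy
      have hlt : (insert y (B₁.erase x) \ B₂).card < n := by
        rw [← hn]
        apply Finset.card_lt_card
        refine ⟨fun z hz => ?_, fun h => ?_⟩
        · simp only [Finset.mem_sdiff, Finset.mem_insert, Finset.mem_erase] at hz ⊢
          rcases hz with ⟨rfl | h, h'⟩
          · exact absurd hy.1 h'
          · exact ⟨h.2, h'⟩
        · have := h (Finset.mem_sdiff.2 hx)
          simp only [Finset.mem_sdiff, Finset.mem_insert, Finset.mem_erase] at this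
          rcases this with ⟨rfl | h, h'⟩
          · exact hx.2 hy.1
          · exact h.1 rfl
      have := ih _ hlt _ hB rfl
      rw [← this, Finset.card_insert_of_notMem (by simp [hy.2]), Finset.card_erase_add_one hx.1]
    · rw [Finset.not_nonempty_iff_eq_empty, Finset.sdiff_eq_empty_iff_subset] at he
      have : B₂ ⊆ B₁ := by
        intro x hx
        by_contra hxn
        obtain ⟨y, hy, -⟩ := hM.2.2 B₂ h2 B₁ h1 x (by simp [hx, hxn])
        simp at hy
        exact hy.2 (he hy.1)
      rw [Finset.Subset.antisymm he this]

theorem le_famRank {B : Finset ℕ} (hB : B ∈ ℬ) (A : Finset ℕ) : (A ∩ B).card ≤ famRank ℬ A :=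
  Finset.le_sup (f := fun B => (A ∩ B).card) hB

theorem exists_famRank (hM : IsBasisFamily E ℬ) (A : Finset ℕ) : ∃ B ∈ ℬ, (A ∩ B).card = famRank ℬ A := by
  obtain ⟨B, hB, h⟩ := Finset.exists_mem_eq_sup ℬ hM.1 (fun B => (A ∩ B).card)
  exact ⟨B, hB, h.symm⟩

theorem improve (hM : IsBasisFamily E ℬ) {X Y : Finset ℕ} (hXY : X ⊆ Y) (B₂ : Finset ℕ) (h2 : B₂ ∈ ℬ) (n : ℕ) :
    ∀ B₁ ∈ ℬ, (B₁ \ B₂).card = n → (Y ∩ B₁).card < (Y ∩ B₂).card →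
    ∃ B ∈ ℬ, (X ∩ B₁) ⊆ (X ∩ B) ∧ (Y ∩ B₁).card < (Y ∩ B).card := by
  induction n using Nat.strong_induction_on with
  | _ n ih =>
    intro B₁ h1 hn hlt
    have hc := card_eq_of_bases hM B₁ B₂ h1 h2
    have a1 := Finset.card_sdiff_add_card_inter B₁ Y
    have a2 := Finset.card_sdiff_add_card_inter B₂ Y
    rw [Finset.inter_comm] at a1 a2
    have : ∃ x ∈ B₁ \ Y, x ∉ B₂ \ Y := by
      by_contra hcon
      push Not at hcon
      have := Finset.card_le_card (show B₁ \ Y ⊆ B₂ \ Y from hcon)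
      omega
    obtain ⟨x, hx, hx2⟩ := this
    simp only [Finset.mem_sdiff, not_and, not_not] at hx hx2
    have hx2 : x ∉ B₂ := fun h => hx.2 (hx2 h)
    obtain ⟨y, hy, hB⟩ := hM.2.2 B₁ h1 B₂ h2 x (by simp [hx.1, hx2])
    simp only [Finset.mem_sdiff] at hy
    have hYs : Y ∩ B₁ ⊆ Y ∩ insert y (B₁.erase x) := by
      intro z hz
      simp only [Finset.mem_inter, Finset.mem_insert, Finset.mem_erase] at hz ⊢
      refine ⟨hz.1, Or.inr ⟨?_, hz.2⟩⟩
      rintro rfl; exact hx.2 hz.1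
    have hXs : X ∩ B₁ ⊆ X ∩ insert y (B₁.erase x) := by
      intro z hz
      simp only [Finset.mem_inter] at hz ⊢
      have := hYs (Finset.mem_inter.2 ⟨hXY hz.1, hz.2⟩)
      simp only [Finset.mem_inter] at this
      exact ⟨hz.1, this.2⟩
    by_cases hlt' : (Y ∩ B₁).card < (Y ∩ insert y (B₁.erase x)).card
    · exact ⟨_, hB, hXs, hlt'⟩
    · have heq : (Y ∩ B₁).card = (Y ∩ insert y (B₁.erase x)).card :=
        le_antisymm (Finset.card_le_card hYs) (not_lt.1 hlt')
      have hlt2 : (insert y (B₁.erase x) \ B₂).card < n := by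
        rw [← hn]
        apply Finset.card_lt_card
        refine ⟨fun z hz => ?_, fun h => ?_⟩
        · simp only [Finset.mem_sdiff, Finset.mem_insert, Finset.mem_erase] at hz ⊢
          rcases hz with ⟨rfl | h, h'⟩
          · exact absurd hy.1 h'
          · exact ⟨h.2, h'⟩
        · have := h (Finset.mem_sdiff.2 ⟨hx.1, hx2⟩)
          simp only [Finset.mem_sdiff, Finset.mem_insert, Finset.mem_erase] at this
          rcases this with ⟨rfl | h, h'⟩
          · exact hx2 hy.1
          · exact h.1 rfl
      obtain ⟨B, h3, h4, h5⟩ := ih _ hlt2 _ hB rfl (heq ▸ hlt)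
      exact ⟨B, h3, hXs.trans h4, heq ▸ h5⟩

theorem exists_both (hM : IsBasisFamily E ℬ) {X Y : Finset ℕ} (hXY : X ⊆ Y) :
    ∀ B₁ ∈ ℬ, ∃ B ∈ ℬ, X ∩ B₁ ⊆ X ∩ B ∧ (Y ∩ B).card = famRank ℬ Y := by
  intro B₁ h1
  obtain ⟨B, hB, hmax⟩ := Finset.exists_max_image (ℬ.filter fun B => X ∩ B₁ ⊆ X ∩ B)
    (fun B => (Y ∩ B).card) ⟨B₁, by simp [h1]⟩
  simp only [Finset.mem_filter] at hB hmax
  refine ⟨B, hB.1, hB.2, le_antisymm (le_famRank hB.1 Y) ?_⟩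
  by_contra hlt
  push Not at hlt
  obtain ⟨B₂, h2, h2'⟩ := exists_famRank hM Y
  obtain ⟨B', h3, h4, h5⟩ := improve hM hXY B₂ h2 _ B hB.1 rfl (by omega)
  have := hmax B' ⟨h3, hB.2.trans h4⟩
  omega

theorem famRank_rankFn (hM : IsBasisFamily E ℬ) : RankFn (famRank ℬ) where
  empty := by simp [famRank]
  mono := by
    intro A B h
    obtain ⟨B', h1, h2⟩ := exists_famRank hM A
    rw [← h2]
    exact (Finset.card_le_card (Finset.inter_subset_inter_right h)).trans (le_famRank h1 B)
  unit := by
    intro e A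
    obtain ⟨B, h1, h2⟩ := exists_famRank hM (insert e A)
    rw [← h2]
    have := le_famRank h1 A
    have h3 : (insert e A ∩ B).card ≤ (insert e (A ∩ B)).card := Finset.card_le_card (by
      intro x; simp; tauto)
    have := Finset.card_insert_le e (A ∩ B)
    omega
  submod := by
    intro A B
    obtain ⟨B₁, h1, h1'⟩ := exists_famRank hM (A ∩ B)
    obtain ⟨B₂, h2, h3, h4⟩ := exists_both hM
      (show A ∩ B ⊆ A ∪ B from Finset.inter_subset_left.trans Finset.subset_union_left) B₁ h1
    have h5 := Finset.card_le_card h3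
    have h6 := le_famRank h2 A
    have h7 := le_famRank h2 B
    have h8 := Finset.card_union_add_card_inter (A ∩ B₂) (B ∩ B₂)
    have e1 : A ∩ B₂ ∪ B ∩ B₂ = (A ∪ B) ∩ B₂ := by ext; simp; tauto
    have e2 : A ∩ B₂ ∩ (B ∩ B₂) = (A ∩ B) ∩ B₂ := by ext; simp
    rw [e1, e2] at h8
    omega

theorem famRank_ground (hM : IsBasisFamily E ℬ) {B : Finset ℕ} (hB : B ∈ ℬ) : famRank ℬ E = B.card := by
  obtain ⟨B₁, h1, h2⟩ := exists_famRank hM E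
  rw [← h2, Finset.inter_eq_right.2 (hM.2.1 _ h1), card_eq_of_bases hM _ _ h1 hB]

theorem basesOfRank_famRank (hM : IsBasisFamily E ℬ) : basesOfRank E (famRank ℬ) = ℬ := by
  ext B
  simp only [basesOfRank, Finset.mem_filter, Finset.mem_powerset]
  constructor
  · rintro ⟨h1, h2, h3⟩
    obtain ⟨B', h4, h5⟩ := exists_famRank hM B
    have h6 : B ∩ B' = B := Finset.eq_of_subset_of_card_le Finset.inter_subset_left (by omega)
    rw [Finset.inter_eq_left] at h6
    rw [famRank_ground hM h4] at h3
    rwa [Finset.eq_of_subset_of_card_le h6 (by omega)]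
  · intro hB
    refine ⟨hM.2.1 B hB, ?_⟩
    have h1 := le_famRank hB B
    have h2 := (famRank_rankFn hM).le_card B
    have h3 := famRank_ground hM hB
    simp only [Finset.inter_self] at h1
    omega

theorem isCyclicFlat_iff (hM : IsBasisFamily E ℬ) {F : Finset ℕ} : IsCyclicFlat E ℬ F ↔
    F ⊆ E ∧ (∀ e ∈ E, famRank ℬ (insert e F) = famRank ℬ F → e ∈ F) ∧
      ∀ e ∈ F, famRank ℬ (F.erase e) = famRank ℬ F := by
  unfold IsCyclicFlat IsFlat
  rw [and_assoc]
  have hr := famRank_rankFn hM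
  refine and_congr_right fun hF => and_congr_right fun _ => forall₂_congr fun e he => ?_
  simp only [famRestrict, Finset.mem_filter, Finset.mem_image]
  constructor
  · intro h
    push Not at h
    obtain ⟨S, ⟨⟨B, hB, rfl⟩, hmax⟩, heS⟩ := h
    obtain ⟨B', hB', h1, h2⟩ := exists_both hM (subset_refl F) B hB
    have h3 := hmax (B' ∩ F) ⟨B', hB', rfl⟩ (by rwa [Finset.inter_comm B, Finset.inter_comm B'])
    refine le_antisymm (hr.mono (Finset.erase_subset _ _)) ?_
    rw [← h2]
    refine le_trans (Finset.card_le_card ?_) (le_famRank hB' _)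
    intro z hz
    rw [Finset.inter_comm, ← h3] at hz
    have : z ≠ e := by rintro rfl; exact heS hz
    rw [h3] at hz
    simp only [Finset.mem_inter, Finset.mem_erase] at hz ⊢
    tauto
  · intro h hall
    obtain ⟨B, hB, h1⟩ := exists_famRank hM (F.erase e)
    have h2 := le_famRank hB F
    have h3 : F.erase e ∩ B = F ∩ B :=
      Finset.eq_of_subset_of_card_le (Finset.inter_subset_inter_right (Finset.erase_subset _ _))
        (by omega)
    have := hall (B ∩ F) ⟨⟨B, hB, rfl⟩, ?_⟩
    · rw [Finset.inter_comm, ← h3] at this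
      simp at this
    · rintro T ⟨B', hB', rfl⟩ hs
      refine Finset.eq_of_subset_of_card_le hs ?_
      have := le_famRank hB' F
      rw [Finset.inter_comm B', Finset.inter_comm B]
      rw [h3] at h1
      omega

end fam

section Part2

open Filter Topology

/-- extension by zero -/
noncomputable def ext0 {E : Finset ℕ} (x : ↑E → ℝ) : ℕ → ℝ :=
  fun n => if h : n ∈ E then x ⟨n, h⟩ else 0

/-- the value `x(A)` -/
noncomputable def vs {E : Finset ℕ} (x : ↑E → ℝ) (A : Finset ℕ) : ℝ := ∑ n ∈ A, ext0 x n

section vs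
variable {E : Finset ℕ}

theorem ext0_coe (x : ↑E → ℝ) (e : ↑E) : ext0 x e = x e := by simp [ext0]

theorem ext0_mem (x : ↑E → ℝ) {n : ℕ} (h : n ∈ E) : ext0 x n = x ⟨n, h⟩ := by simp [ext0, h]

theorem vs_add (x y : ↑E → ℝ) (A : Finset ℕ) : vs (x + y) A = vs x A + vs y A := by
  unfold vs
  rw [← Finset.sum_add_distrib]
  refine Finset.sum_congr rfl fun n _ => ?_
  unfold ext0; split_ifs <;> simp

theorem vs_smul (c : ℝ) (x : ↑E → ℝ) (A : Finset ℕ) : vs (c • x) A = c * vs x A := by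
  unfold vs
  rw [Finset.mul_sum]
  refine Finset.sum_congr rfl fun n _ => ?_
  unfold ext0; split_ifs <;> simp

theorem vs_single (e : ↑E) (c : ℝ) (A : Finset ℕ) :
    vs (Pi.single e c) A = if (e : ℕ) ∈ A then c else 0 := by
  unfold vs
  have : ∀ n, ext0 (Pi.single e c : ↑E → ℝ) n = if n = e then c else 0 := by
    intro n
    unfold ext0
    by_cases h : n ∈ E
    · by_cases h2 : n = e
      · subst h2; simp
      · simp [h, h2, Subtype.ext_iff]
    · have : n ≠ e := by rintro rfl; exact h e.2
      simp [h, this]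
  simp [this]

theorem vs_continuous (A : Finset ℕ) : Continuous (fun x : ↑E → ℝ => vs x A) := by
  unfold vs
  refine continuous_finsetSum _ fun n _ => ?_
  unfold ext0
  split_ifs <;> fun_prop

theorem vs_union_inter (x : ↑E → ℝ) (A B : Finset ℕ) :
    vs x (A ∪ B) + vs x (A ∩ B) = vs x A + vs x B := Finset.sum_union_inter

theorem vs_sdiff (x : ↑E → ℝ) {A B : Finset ℕ} (h : A ⊆ B) :
    vs x (B \ A) + vs x A = vs x B := Finset.sum_sdiff h

theorem vs_empty (x : ↑E → ℝ) : vs x ∅ = 0 := rfl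

theorem vs_singleton (x : ↑E → ℝ) (e : ↑E) : vs x {(e : ℕ)} = x e := by
  simp [vs, ext0_coe]

theorem vs_insert (x : ↑E → ℝ) (e : ↑E) {A : Finset ℕ} (h : (e : ℕ) ∉ A) :
    vs x (insert (e : ℕ) A) = x e + vs x A := by
  simp [vs, ext0_coe, h]

theorem vs_erase (x : ↑E → ℝ) (e : ↑E) {A : Finset ℕ} (h : (e : ℕ) ∈ A) :
    vs x (A.erase (e : ℕ)) + x e = vs x A := by
  rw [← ext0_coe x e]
  exact Finset.sum_erase_add _ _ h

theorem ext0_nonneg {x : ↑E → ℝ} (hx : ∀ e, 0 ≤ x e) (n : ℕ) : 0 ≤ ext0 x n := by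
  unfold ext0; split_ifs
  · exact hx _
  · exact le_rfl

theorem vs_mono {x : ↑E → ℝ} (hx : ∀ e, 0 ≤ x e) {A B : Finset ℕ} (h : A ⊆ B) :
    vs x A ≤ vs x B :=
  Finset.sum_le_sum_of_subset_of_nonneg h fun n _ _ => ext0_nonneg hx n

theorem vs_basisVector {B : Finset ℕ} (hB : B ⊆ E) (A : Finset ℕ) :
    vs (basisVector E B) A = (A ∩ B).card := by
  unfold vs
  have : ∀ n, ext0 (basisVector E B) n = if n ∈ B then 1 else 0 := by
    intro n
    unfold ext0 basisVector
    split_ifs with h1 h2 h2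
    · rfl
    · rfl
    · exact absurd (hB h2) h1
    · rfl
  simp [this]

end vs

/-- polytope of a rank function -/
def Pol (E : Finset ℕ) (r : Finset ℕ → ℕ) : Set (↑E → ℝ) :=
  {x | (∀ e, 0 ≤ x e) ∧ (∀ A ⊆ E, vs x A ≤ r A) ∧ vs x E = r E}

section
variable {E : Finset ℕ} {r : Finset ℕ → ℕ}

theorem convex_Pol : Convex ℝ (Pol E r) := by
  rintro x ⟨h1, h2, h3⟩ y ⟨k1, k2, k3⟩ a b ha hb hab
  refine ⟨fun e => ?_, fun A hA => ?_, ?_⟩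
  · have := h1 e; have := k1 e
    simp only [Pi.add_apply, Pi.smul_apply, smul_eq_mul]; positivity
  · rw [vs_add, vs_smul, vs_smul]
    calc _ ≤ a * r A + b * r A := by gcongr; exacts [h2 A hA, k2 A hA]
      _ = r A := by rw [← add_mul, hab, one_mul]
  · rw [vs_add, vs_smul, vs_smul, h3, k3, ← add_mul, hab, one_mul]

theorem isClosed_Pol : IsClosed (Pol E r) := by
  have : Pol E r = (⋂ e, {x | 0 ≤ x e}) ∩ ((⋂ A, ⋂ (_ : A ⊆ E), {x | vs x A ≤ r A})
      ∩ {x | vs x E = r E}) := by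
    ext x; simp [Pol]
  rw [this]
  refine (isClosed_iInter fun e => isClosed_le continuous_const (continuous_apply e)).inter
    ((isClosed_iInter fun A => isClosed_iInter fun _ =>
      isClosed_le (vs_continuous A) continuous_const).inter
      (isClosed_eq (vs_continuous E) continuous_const))

theorem Pol_le_one (hr : RankFn r) {x : ↑E → ℝ} (hx : x ∈ Pol E r) (e : ↑E) : x e ≤ 1 := by
  have h := hx.2.1 {(e : ℕ)} (by simp)
  rw [vs_singleton] at h
  have := hr.le_card {(e : ℕ)}
  simp only [Finset.card_singleton] at this
  exact h.trans (by exact_mod_cast this)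

theorem isCompact_Pol (hr : RankFn r) : IsCompact (Pol E r) := by
  refine (isCompact_Icc (a := (0 : ↑E → ℝ)) (b := 1)).of_isClosed_subset isClosed_Pol ?_
  intro x hx
  exact ⟨fun e => hx.1 e, fun e => Pol_le_one hr hx e⟩

theorem basisVector_mem_Pol (hr : RankFn r) {B : Finset ℕ} (hB : B ∈ basesOfRank E r) :
    basisVector E B ∈ Pol E r := by
  simp only [basesOfRank, Finset.mem_filter, Finset.mem_powerset] at hB
  obtain ⟨h1, h2, h3⟩ := hB
  refine ⟨fun e => ?_, fun A hA => ?_, ?_⟩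
  · unfold basisVector; split_ifs <;> norm_num
  · rw [vs_basisVector h1]
    have h4 := hr.indep_subset (Finset.inter_subset_right (s₁ := A)) h2
    have := hr.mono (Finset.inter_subset_left (s₁ := A) (s₂ := B))
    rw [h4] at this
    exact_mod_cast this
  · rw [vs_basisVector h1, Finset.inter_eq_right.2 h1, ← h3, h2]

theorem tight_inter (hr : RankFn r) {x : ↑E → ℝ} (h : ∀ A ⊆ E, vs x A ≤ r A) {A B : Finset ℕ}
    (hA : A ⊆ E) (hB : B ⊆ E) (h1 : vs x A = r A) (h2 : vs x B = r B) :
    vs x (A ∩ B) = r (A ∩ B) := by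
  have h3 := vs_union_inter x A B
  have h4 : ((r (A ∪ B) + r (A ∩ B) : ℕ) : ℝ) ≤ (r A + r B : ℕ) := by
    exact_mod_cast hr.submod A B
  push_cast at h4
  have h5 := h (A ∪ B) (Finset.union_subset hA hB)
  have h6 := h (A ∩ B) (Finset.inter_subset_left.trans hA)
  linarith

theorem extreme_integral (hr : RankFn r) {x : ↑E → ℝ} (hx : x ∈ (Pol E r).extremePoints ℝ) :
    ∀ e, x e = 0 ∨ x e = 1 := by
  by_contra hcon
  push Not at hcon
  obtain ⟨hxP, hext⟩ := hx
  obtain ⟨e₀, he₀⟩ := hcon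
  obtain ⟨T, hT, hmin⟩ := Finset.exists_min_image
    (E.powerset.filter fun A => vs x A = r A ∧ ∃ e : ↑E, (e : ℕ) ∈ A ∧ x e ≠ 0 ∧ x e ≠ 1)
    Finset.card ⟨E, by
      simp only [Finset.mem_filter, Finset.mem_powerset]
      exact ⟨subset_rfl, hxP.2.2, e₀, e₀.2, he₀⟩⟩
  simp only [Finset.mem_filter, Finset.mem_powerset] at hT hmin
  obtain ⟨hTE, hTt, e, heT, he⟩ := hT
  have hprop : ∀ A ⊆ E, vs x A = r A → ∀ e : ↑E, (e : ℕ) ∈ A → (e : ℕ) ∈ T → x e ≠ 0 → x e ≠ 1 →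
      T ⊆ A := by
    intro A hA ht e heA heT h0 h1
    have h3 := hmin (A ∩ T) ⟨Finset.inter_subset_right.trans hTE,
      tight_inter hr hxP.2.1 hA hTE ht hTt, e, Finset.mem_inter.2 ⟨heA, heT⟩, h0, h1⟩
    have := Finset.eq_of_subset_of_card_le Finset.inter_subset_right h3
    exact Finset.inter_eq_right.1 this
  have hsec : ∃ g : ↑E, (g : ℕ) ∈ T ∧ g ≠ e ∧ x g ≠ 0 ∧ x g ≠ 1 := by
    by_contra hno
    push Not at hno
    have hinter : vs x (T.erase e) = (((T.erase e).filter fun n => ext0 x n = 1).card : ℝ) := by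
      unfold vs
      rw [Finset.card_filter]
      push_cast
      refine Finset.sum_congr rfl fun n hn => ?_
      simp only [Finset.mem_erase] at hn
      have hnE := hTE hn.2
      rw [ext0_mem x hnE]
      by_cases h0 : x ⟨n, hnE⟩ = 0
      · simp [h0]
      · have := hno ⟨n, hnE⟩ hn.2 (fun h => hn.1 (by rw [← h])) h0
        simp [this]
    have h1 := vs_erase x e heT
    have h0 : 0 < x e := lt_of_le_of_ne (hxP.1 e) (Ne.symm he.1)
    have h2 : x e < 1 := lt_of_le_of_ne (Pol_le_one hr hxP e) he.2
    rw [hinter, hTt] at h1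
    set k := ((T.erase e).filter fun n => ext0 x n = 1).card
    have h3 : (k : ℝ) < r T := by linarith
    have h4 : (r T : ℝ) < k + 1 := by linarith
    norm_cast at h3 h4
    omega
  obtain ⟨g, hgT, hge, hg⟩ := hsec
  let d : ↑E → ℝ := Pi.single e 1 + (-1 : ℝ) • Pi.single g 1
  have hd : ∀ A, vs d A = (if (e : ℕ) ∈ A then 1 else 0) - (if (g : ℕ) ∈ A then 1 else 0) := by
    intro A
    simp only [d]
    rw [vs_add, vs_smul, vs_single, vs_single]; ring
  have htight : ∀ A ⊆ E, vs x A = r A → vs d A = 0 := by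
    intro A hA ht
    rw [hd]
    by_cases h1 : (e : ℕ) ∈ A
    · have := hprop A hA ht e h1 heT he.1 he.2 hgT
      simp [h1, this]
    · have : (g : ℕ) ∉ A := fun h2 => h1 (hprop A hA ht g h2 hgT hg.1 hg.2 heT)
      simp [h1, this]
  have hev : ∀ᶠ t in 𝓝 (0 : ℝ), x + t • d ∈ Pol E r := by
    have e1 : ∀ᶠ t in 𝓝 (0 : ℝ), ∀ i, 0 ≤ (x + t • d) i := by
      rw [eventually_all]
      intro i
      by_cases hi : x i = 0
      · have hie : i ≠ e := by rintro rfl; exact he.1 hi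
        have hig : i ≠ g := by rintro rfl; exact hg.1 hi
        simp [d, hi, hie, hig]
      · have hpos : 0 < x i := lt_of_le_of_ne (hxP.1 i) (Ne.symm hi)
        have hc : Continuous fun t : ℝ => (x + t • d) i := by
          simp only [Pi.add_apply, Pi.smul_apply, smul_eq_mul]; fun_prop
        have := hc.tendsto 0
        simp only [zero_smul, add_zero] at this
        filter_upwards [this.eventually (lt_mem_nhds hpos)] with t ht using ht.le
    have e2 : ∀ᶠ t in 𝓝 (0 : ℝ), ∀ A ∈ E.powerset, vs (x + t • d) A ≤ r A := by
      rw [Filter.eventually_all_finset]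
      intro A hA
      rw [Finset.mem_powerset] at hA
      by_cases ht : vs x A = r A
      · refine Filter.Eventually.of_forall fun t => ?_
        rw [vs_add, vs_smul, htight A hA ht]; simp [ht]
      · have hlt : vs x A < r A := lt_of_le_of_ne (hxP.2.1 A hA) ht
        have hc : Continuous fun t : ℝ => vs (x + t • d) A := by
          simp only [vs_add, vs_smul]; fun_prop
        have := hc.tendsto 0
        simp only [zero_smul, add_zero] at this
        filter_upwards [this.eventually (gt_mem_nhds hlt)] with t ht using ht.le
    filter_upwards [e1, e2] with t h1 h2
    refine ⟨h1, fun A hA => h2 A (Finset.mem_powerset.2 hA), ?_⟩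
    rw [vs_add, vs_smul, htight E subset_rfl hxP.2.2]; simp [hxP.2.2]
  have hneg : ∀ᶠ t in 𝓝 (0 : ℝ), x + (-t) • d ∈ Pol E r := by
    have : Tendsto (fun t : ℝ => -t) (𝓝 0) (𝓝 0) := by
      simpa using (continuous_neg (G := ℝ)).tendsto 0
    exact this.eventually hev
  have hpos : ∀ᶠ t in 𝓝[>] (0 : ℝ), 0 < t := self_mem_nhdsWithin
  obtain ⟨t, ht1, ht2, ht3⟩ := (((hev.filter_mono nhdsWithin_le_nhds).and
    ((hneg.filter_mono nhdsWithin_le_nhds).and hpos))).exists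
  have hseg : x ∈ openSegment ℝ (x + t • d) (x + (-t) • d) := by
    refine ⟨1/2, 1/2, by norm_num, by norm_num, by norm_num, ?_⟩
    ext i; simp; ring
  have := congrFun (hext ht1 ht2 hseg) e
  simp [d, hge.symm] at this
  exact ht3.ne' this

theorem edmonds (hr : RankFn r) : basePolytope E (basesOfRank E r) = Pol E r := by
  apply Set.Subset.antisymm
  · refine convexHull_min ?_ convex_Pol
    rintro _ ⟨B, hB, rfl⟩
    exact basisVector_mem_Pol hr (by exact_mod_cast hB)
  · rw [← closure_convexHull_extremePoints (isCompact_Pol (E := E) hr) convex_Pol]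
    have hfin : (basisVector E '' (↑(basesOfRank E r) : Set (Finset ℕ))).Finite :=
      (Finset.finite_toSet _).image _
    refine closure_minimal (convexHull_mono ?_) (hfin.isClosed_convexHull ℝ)
    intro x hx
    have hinter := extreme_integral hr hx
    have hxP := hx.1
    let B := E.filter fun n => ext0 x n = 1
    have hB : B ⊆ E := Finset.filter_subset _ _
    have hxB : basisVector E B = x := by
      funext e
      unfold basisVector
      simp only [B, Finset.mem_filter, ext0_coe, e.2, true_and]
      rcases hinter e with h | h <;> simp [h]
    refine ⟨B, ?_, hxB⟩
    have h1 := hxP.2.1 B hB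
    have h2 := hxP.2.2
    rw [← hxB, vs_basisVector hB, Finset.inter_self] at h1
    rw [← hxB, vs_basisVector hB, Finset.inter_eq_right.2 hB] at h2
    norm_cast at h1 h2
    have := hr.le_card B
    simp only [basesOfRank, Finset.coe_filter, Finset.mem_powerset, Set.mem_ofPred_eq]
    refine ⟨hB, by omega, by omega⟩

end

theorem mem_relint_iff {V : Type*} [NormedAddCommGroup V] [NormedSpace ℝ V]
    [FiniteDimensional ℝ V] {ι : Type*} [Finite ι] (l : ι → V → ℝ)
    (hl : ∀ i, IsLinearMap ℝ (l i)) (b : ι → ℝ) (P : Set V)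
    (hP : ∀ x, x ∈ P ↔ ∀ i, l i x ≤ b i) (x : V) :
    x ∈ intrinsicInterior ℝ P ↔ x ∈ P ∧ ∀ i, l i x < b i ∨ ∀ y ∈ P, l i y = b i := by
  have hcont : ∀ i, Continuous (l i) := fun i =>
    (IsLinearMap.mk' (l i) (hl i)).continuous_of_finiteDimensional
  constructor
  · intro hx
    have hxP := intrinsicInterior_subset hx
    refine ⟨hxP, fun i => ?_⟩
    by_contra hcon
    push Not at hcon
    obtain ⟨h1, y, hy, hne⟩ := hcon
    have h1 : l i x = b i := le_antisymm ((hP x).1 hxP i) h1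
    have hylt : l i y < b i := lt_of_le_of_ne ((hP y).1 hy i) hne
    obtain ⟨z, hz, rfl⟩ := mem_intrinsicInterior.1 hx
    have hya : y ∈ affineSpan ℝ P := subset_affineSpan ℝ P hy
    let c : ℝ → affineSpan ℝ P := fun t => ⟨AffineMap.lineMap (z : V) y t,
      AffineMap.lineMap_mem t z.2 hya⟩
    have hc : Continuous c := by
      refine Continuous.subtype_mk ?_ _
      exact AffineMap.lineMap_continuous
    have hc0 : c 0 = z := by ext; simp [c]
    have hev : ∀ᶠ t in 𝓝 (0 : ℝ), (c t : V) ∈ P := by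
      have := hc.tendsto 0
      rw [hc0] at this
      exact this.eventually (mem_interior_iff_mem_nhds.1 hz)
    have hneg : ∀ᶠ t in 𝓝[<] (0 : ℝ), t < 0 := self_mem_nhdsWithin
    obtain ⟨t, ht1, ht2⟩ := ((hev.filter_mono nhdsWithin_le_nhds).and hneg).exists
    have h3 := (hP _).1 ht1 i
    have h4 : l i (c t) = l i z + t * (l i y - l i z) := by
      simp only [c, AffineMap.lineMap_apply, vsub_eq_sub, vadd_eq_add]
      rw [(hl i).map_add, (hl i).map_smul, (hl i).map_sub, smul_eq_mul]; ring
    rw [h4, h1] at h3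
    nlinarith
  · rintro ⟨hxP, h⟩
    have hxa : x ∈ affineSpan ℝ P := subset_affineSpan ℝ P hxP
    refine mem_intrinsicInterior.2 ⟨⟨x, hxa⟩, ?_, rfl⟩
    rw [mem_interior_iff_mem_nhds]
    have hspan : ∀ i, (∀ y ∈ P, l i y = b i) → ∀ y ∈ affineSpan ℝ P, l i y = b i := by
      intro i hi y hy
      refine affineSpan_induction (p := fun y => l i y = b i) hy hi ?_
      intro c u v w hu hv hw
      simp only [vsub_eq_sub, vadd_eq_add]
      rw [(hl i).map_add, (hl i).map_smul, (hl i).map_sub, hu, hv, hw]; simp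
    have hall : ∀ᶠ z : affineSpan ℝ P in 𝓝 (⟨x, hxa⟩ : affineSpan ℝ P), ∀ i, l i z ≤ b i := by
      rw [eventually_all]
      intro i
      rcases h i with hi | hi
      · have : Tendsto (fun z : affineSpan ℝ P => l i z) (𝓝 ⟨x, hxa⟩) (𝓝 (l i x)) :=
          ((hcont i).comp continuous_subtype_val).tendsto _
        filter_upwards [this.eventually (gt_mem_nhds hi)] with z hz using hz.le
      · exact Eventually.of_forall fun z => (hspan i hi z z.2).le
    filter_upwards [hall] with z hz
    exact (hP z).2 hz

theorem isLinear_vs {E : Finset ℕ} (A : Finset ℕ) :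
    IsLinearMap ℝ (fun x : ↑E → ℝ => vs x A) :=
  ⟨fun x y => vs_add x y A, fun c x => by simp [vs_smul]⟩

/-- relative interior for a general rank function -/
theorem mem_relint_Pol {E : Finset ℕ} {r : Finset ℕ → ℕ} (hr : RankFn r)
    (hloop : ∀ e ∈ E, r {e} = 1) (x : ↑E → ℝ) :
    x ∈ intrinsicInterior ℝ (Pol E r) ↔ x ∈ Pol E r ∧ (∀ e, 0 < x e) ∧
      ∀ A ⊆ E, vs x A = r A → r A + r (E \ A) = r E := by
  let l : ↑E ⊕ ↑E.powerset ⊕ Unit → (↑E → ℝ) → ℝ := fun i x => match i with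
    | .inl e => - x e
    | .inr (.inl A) => vs x A
    | .inr (.inr _) => - vs x E
  let b : ↑E ⊕ ↑E.powerset ⊕ Unit → ℝ := fun i => match i with
    | .inl e => 0
    | .inr (.inl A) => r A
    | .inr (.inr _) => - (r E : ℝ)
  have hl : ∀ i, IsLinearMap ℝ (l i) := by
    rintro (e | A | u)
    · exact ⟨fun x y => by simp [l]; ring, fun c x => by simp [l]⟩
    · exact isLinear_vs _
    · exact ⟨fun x y => by simp [l, vs_add]; ring, fun c x => by simp [l, vs_smul]⟩
  have hP : ∀ x, x ∈ Pol E r ↔ ∀ i, l i x ≤ b i := by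
    intro x
    constructor
    · rintro ⟨h1, h2, h3⟩ (e | A | u)
      · simpa [l, b] using h1 e
      · exact h2 A (Finset.mem_powerset.1 A.2)
      · simp [l, b, h3]
    · intro h
      refine ⟨fun e => by simpa [l, b] using h (.inl e),
        fun A hA => h (.inr (.inl ⟨A, Finset.mem_powerset.2 hA⟩)), le_antisymm
          (h (.inr (.inl ⟨E, Finset.mem_powerset.2 subset_rfl⟩))) ?_⟩
      simpa [l, b] using h (.inr (.inr ()))
  rw [mem_relint_iff l hl b _ hP]
  refine and_congr_right fun hx => ?_
  constructor
  · intro h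
    refine ⟨fun e => ?_, fun A hA ht => ?_⟩
    · rcases h (.inl e) with h1 | h1
      · simpa [l, b] using h1
      · exfalso
        obtain ⟨B, h2, h3, h4, h5⟩ := hr.exists_extend (I := {(e : ℕ)}) (A := E) (by simp)
          (by simp [hloop e e.2])
        have := h1 (basisVector E B) (basisVector_mem_Pol hr (by
          simp only [basesOfRank, Finset.mem_filter, Finset.mem_powerset]; exact ⟨h3, h4, h5⟩))
        have h6 : (e : ℕ) ∈ B := h2 (by simp)
        simp [l, b, basisVector, h6] at this
    · rcases h (.inr (.inl ⟨A, Finset.mem_powerset.2 hA⟩)) with h1 | h1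
      · exact absurd ht h1.ne
      · obtain ⟨I, -, hI1, hI2, hI3⟩ := hr.exists_extend (Finset.empty_subset (E \ A))
          (by simp [hr.empty])
        obtain ⟨B, h2, h3, h4, h5⟩ := hr.exists_extend (hI1.trans Finset.sdiff_subset) hI2
        have h6 := h1 (basisVector E B) (basisVector_mem_Pol hr (by
          simp only [basesOfRank, Finset.mem_filter, Finset.mem_powerset]; exact ⟨h3, h4, h5⟩))
        simp only [l, b, vs_basisVector h3] at h6
        norm_cast at h6
        have h7 : I ∪ (A ∩ B) ⊆ B := Finset.union_subset h2 Finset.inter_subset_right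
        have h8 := Finset.card_le_card h7
        have hdis : Disjoint I (A ∩ B) := by
          refine Finset.disjoint_left.2 fun a ha hb => ?_
          have := hI1 ha
          simp only [Finset.mem_sdiff, Finset.mem_inter] at this hb
          exact this.2 hb.1
        rw [Finset.card_union_of_disjoint hdis] at h8
        have := hr.submod A (E \ A)
        rw [Finset.union_sdiff_of_subset hA] at this
        omega
  · rintro ⟨h1, h2⟩ (e | A | u)
    · left; simpa [l, b] using h1 e
    · have hA := Finset.mem_powerset.1 A.2
      by_cases ht : vs x A = r A
      · right
        intro y hy
        have h3 := h2 A hA ht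
        have h4 := hy.2.1 _ (Finset.sdiff_subset (s := E) (t := (A : Finset ℕ)))
        have h5 := hy.2.1 _ hA
        have h6 := vs_sdiff y hA
        rw [hy.2.2, ← h3] at h6
        push_cast at h6
        simp only [l, b]
        linarith
      · left; exact lt_of_le_of_ne (hx.2.1 _ hA) ht
    · right
      intro y hy
      simp [l, b, hy.2.2]


end Part2

/-- chain with strictly increasing rank and nullity -/
structure GoodChain (E : Finset ℕ) (r : Finset ℕ → ℕ) (C : Finset (Finset ℕ)) : Prop where
  sub : ∀ Z ∈ C, Z ⊆ E
  chain : IsChain (· ⊆ ·) (↑C : Set (Finset ℕ))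
  bot : ∅ ∈ C
  top : E ∈ C
  rk : ∀ Z ∈ C, ∀ Z' ∈ C, Z ⊂ Z' → r Z < r Z'
  nul : ∀ Z ∈ C, ∀ Z' ∈ C, Z ⊂ Z' → r Z' + Z.card < r Z + Z'.card

theorem GoodChain.exists_point {E : Finset ℕ} {r : Finset ℕ → ℕ} {C : Finset (Finset ℕ)}
    (hr : r ∅ = 0) (hC : GoodChain E r C) (n : ℕ) :
    ∀ Z ∈ C, Z.card = n → Z ≠ ∅ → ∀ t : ℝ, (r Z : ℝ) - 1 < t → t ≤ r Z →
    ∃ y : ℕ → ℝ, (∀ a ∈ Z, 0 < y a ∧ y a < 1) ∧ ∑ a ∈ Z, y a = t ∧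
      ∀ Z' ∈ C, Z' ⊂ Z → Z' ≠ ∅ → ∑ a ∈ Z', y a < r Z' := by
  induction n using Nat.strong_induction_on with
  | _ n ih =>
    intro Z hZ hn hne t ht1 ht2
    obtain ⟨Y, hY, hmax⟩ := Finset.exists_max_image (C.filter (· ⊂ Z)) Finset.card
      ⟨∅, by simp [hC.bot, Finset.nonempty_iff_ne_empty.2 hne]⟩
    simp only [Finset.mem_filter] at hY hmax
    obtain ⟨hYC, hYZ⟩ := hY
    have hle : ∀ Z' ∈ C, Z' ⊂ Z → Z' ⊆ Y := by
      intro Z' h1 h2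
      rcases hC.chain.total h1 hYC with h | h
      · exact h
      · exact (Finset.eq_of_subset_of_card_le h (hmax Z' ⟨h1, h2⟩)).symm.subset
    have h1 := hC.rk Y hYC Z hZ hYZ
    have h2 := hC.nul Y hYC Z hZ hYZ
    have hcd := Finset.card_lt_card hYZ
    obtain ⟨y, t', hy1, hy2, hy3, ht3, ht4⟩ : ∃ (y : ℕ → ℝ) (t' : ℝ),
        (∀ a ∈ Y, 0 < y a ∧ y a < 1) ∧ ∑ a ∈ Y, y a = t' ∧
        (∀ Z' ∈ C, Z' ⊆ Y → Z' ≠ ∅ → ∑ a ∈ Z', y a < r Z') ∧ (r Y : ℝ) - 1 < t' ∧ t' ≤ r Y := by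
      by_cases hY0 : Y = ∅
      · refine ⟨0, 0, by simp [hY0], by simp, ?_, by simp [hY0, hr], by simp⟩
        intro Z' _ h h'
        rw [hY0] at h
        exact absurd (Finset.subset_empty.1 h) h'
      · obtain ⟨y, a1, a2, a3⟩ := ih Y.card (by omega) Y hYC rfl hY0 ((r Y : ℝ) - 1/2)
          (by linarith) (by linarith)
        refine ⟨y, (r Y : ℝ) - 1/2, a1, a2, ?_, by linarith, by linarith⟩
        intro Z' b1 b2 b3
        rcases eq_or_ssubset_of_subset b2 with rfl | h
        · rw [a2]; linarith
        · exact a3 Z' b1 h b3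
    have hcs := Finset.card_sdiff_add_card_eq_card hYZ.subset
    have hm : (0 : ℝ) < ((Z \ Y).card : ℝ) := by
      have : 0 < (Z \ Y).card := by omega
      exact_mod_cast this
    have hm1 : (r Z : ℝ) - r Y + 1 ≤ ((Z \ Y).card : ℝ) := by
      have : r Z + 1 ≤ r Y + (Z \ Y).card := by omega
      have : ((r Z + 1 : ℕ) : ℝ) ≤ (r Y + (Z \ Y).card : ℕ) := by exact_mod_cast this
      push_cast at this; linarith
    have h1' : (r Y : ℝ) + 1 ≤ r Z := by exact_mod_cast h1
    set v : ℝ := (t - t') / ((Z \ Y).card : ℝ) with hv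
    have hv0 : 0 < v := div_pos (by linarith) hm
    have hv1 : v < 1 := by rw [hv, div_lt_one hm]; linarith
    have hsumY : ∀ Z' ⊆ Y, ∑ a ∈ Z', (if a ∈ Y then y a else v) = ∑ a ∈ Z', y a := by
      intro Z' h
      refine Finset.sum_congr rfl fun a ha => by simp [h ha]
    refine ⟨fun a => if a ∈ Y then y a else v, ?_, ?_, ?_⟩
    · intro a ha
      by_cases haY : a ∈ Y
      · simpa [haY] using hy1 a haY
      · simp [haY, hv0, hv1]
    · rw [← Finset.sum_sdiff hYZ.subset, hsumY Y subset_rfl, hy2]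
      have : ∑ a ∈ Z \ Y, (if a ∈ Y then y a else v) = ∑ a ∈ Z \ Y, v :=
        Finset.sum_congr rfl fun a ha => by simp [(Finset.mem_sdiff.1 ha).2]
      rw [this, Finset.sum_const, nsmul_eq_mul, hv]
      field_simp
      ring
    · intro Z' b1 b2 b3
      have := hle Z' b1 b2
      rw [hsumY Z' this]
      exact hy3 Z' b1 this b3

section chain
variable {E : Finset ℕ} {ℬ : Finset (Finset ℕ)} {C : Finset (Finset ℕ)}

theorem chainRank_le {Z : Finset ℕ} (hZ : Z ∈ C) (A : Finset ℕ) :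
    chainRank ℬ C A ≤ famRank ℬ Z + (A \ Z).card := by
  have h : C.Nonempty := ⟨Z, hZ⟩
  simp only [chainRank, h, dif_pos]
  exact Finset.inf'_le _ hZ

theorem exists_chainRank (h : C.Nonempty) (A : Finset ℕ) :
    ∃ Z ∈ C, chainRank ℬ C A = famRank ℬ Z + (A \ Z).card := by
  simp only [chainRank, h, dif_pos]
  exact Finset.exists_mem_eq_inf' h _

theorem chainRank_rankFn (hC : GoodChain E (famRank ℬ) C) : RankFn (chainRank ℬ C) where
  empty := by
    have := chainRank_le (ℬ := ℬ) hC.bot ∅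
    have h0 : famRank ℬ ∅ = 0 := by simp [famRank]
    simpa [h0] using this
  mono := by
    intro A B h
    obtain ⟨Z, h1, h2⟩ := exists_chainRank (ℬ := ℬ) ⟨_, hC.bot⟩ B
    rw [h2]
    refine (chainRank_le h1 A).trans ?_
    gcongr
  unit := by
    intro e A
    obtain ⟨Z, h1, h2⟩ := exists_chainRank (ℬ := ℬ) ⟨_, hC.bot⟩ A
    rw [h2]
    refine (chainRank_le h1 _).trans ?_
    have : (insert e A \ Z).card ≤ (insert e (A \ Z)).card := Finset.card_le_card (by
      intro x; simp; tauto)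
    have := Finset.card_insert_le e (A \ Z)
    omega
  submod := by
    have key : ∀ A B Z₁ Z₂ : Finset ℕ, Z₁ ∈ C → Z₂ ∈ C → Z₁ ⊆ Z₂ →
        chainRank ℬ C (A ∪ B) + chainRank ℬ C (A ∩ B) ≤
          (famRank ℬ Z₁ + (A \ Z₁).card) + (famRank ℬ Z₂ + (B \ Z₂).card) := by
      intro A B Z₁ Z₂ h1 h2 h
      have a1 := chainRank_le (ℬ := ℬ) h2 (A ∪ B)
      have a2 := chainRank_le (ℬ := ℬ) h1 (A ∩ B)
      have a3 := Finset.card_union_add_card_inter (A \ Z₁) (B \ Z₂)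
      have a4 := Finset.card_union_add_card_inter ((A ∪ B) \ Z₂) ((A ∩ B) \ Z₁)
      have a5 : (((A ∪ B) \ Z₂) ∪ ((A ∩ B) \ Z₁)).card ≤ ((A \ Z₁) ∪ (B \ Z₂)).card :=
        Finset.card_le_card (by
          intro x
          have := @h x
          simp only [Finset.mem_union, Finset.mem_sdiff, Finset.mem_inter]; tauto)
      have a6 : (((A ∪ B) \ Z₂) ∩ ((A ∩ B) \ Z₁)).card ≤ ((A \ Z₁) ∩ (B \ Z₂)).card :=
        Finset.card_le_card (by
          intro x
          simp only [Finset.mem_union, Finset.mem_sdiff, Finset.mem_inter]; tauto)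
      omega
    intro A B
    obtain ⟨Z₁, h1, e1⟩ := exists_chainRank (ℬ := ℬ) ⟨_, hC.bot⟩ A
    obtain ⟨Z₂, h2, e2⟩ := exists_chainRank (ℬ := ℬ) ⟨_, hC.bot⟩ B
    rw [e1, e2]
    rcases hC.chain.total h1 h2 with h | h
    · exact key A B Z₁ Z₂ h1 h2 h
    · have := key B A Z₂ Z₁ h2 h1 h
      rw [Finset.union_comm, Finset.inter_comm] at this
      omega

theorem chainRank_ground (hr : RankFn (famRank ℬ)) (hC : GoodChain E (famRank ℬ) C) :
    chainRank ℬ C E = famRank ℬ E := by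
  apply le_antisymm
  · simpa using chainRank_le (ℬ := ℬ) hC.top E
  · obtain ⟨Z₁, h1, e1⟩ := exists_chainRank (ℬ := ℬ) ⟨_, hC.bot⟩ E
    rw [e1]
    exact hr.le_add_card_sdiff Z₁ E

theorem mem_Pol_chain (hr : RankFn (famRank ℬ)) (hC : GoodChain E (famRank ℬ) C) (x : ↑E → ℝ) :
    x ∈ Pol E (chainRank ℬ C) ↔ (∀ e, 0 ≤ x e) ∧ (∀ e, x e ≤ 1) ∧
      (∀ Z ∈ C, vs x Z ≤ famRank ℬ Z) ∧ vs x E = famRank ℬ E := by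
  have hr' := chainRank_rankFn hC
  constructor
  · intro hx
    refine ⟨hx.1, Pol_le_one hr' hx, fun Z hZ => ?_, ?_⟩
    · refine (hx.2.1 Z (hC.sub Z hZ)).trans ?_
      have := chainRank_le (ℬ := ℬ) hZ Z
      simp only [Finset.sdiff_self, Finset.card_empty, add_zero] at this
      exact_mod_cast this
    · rw [hx.2.2, chainRank_ground hr hC]
  · rintro ⟨h1, h2, h3, h4⟩
    refine ⟨h1, fun A hA => ?_, by rw [h4, chainRank_ground hr hC]⟩
    obtain ⟨Z, hZ, e1⟩ := exists_chainRank (ℬ := ℬ) ⟨_, hC.bot⟩ A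
    rw [e1]
    have a1 : vs x A ≤ vs x (Z ∪ (A \ Z)) := vs_mono h1 (by intro y; simp; tauto)
    have a2 := vs_union_inter x Z (A \ Z)
    rw [Finset.inter_sdiff_self, vs_empty] at a2
    have a3 : vs x (A \ Z) ≤ (A \ Z).card := by
      unfold vs
      have := Finset.sum_le_card_nsmul (A \ Z) (ext0 x) 1 (by
        intro n _
        unfold ext0; split_ifs
        · exact h2 _
        · norm_num)
      simpa using this
    have := h3 Z hZ
    push_cast
    linarith

theorem exists_strict (hr : RankFn (famRank ℬ)) (hC : GoodChain E (famRank ℬ) C)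
    (hE : E.Nonempty) : ∃ y : ↑E → ℝ, (∀ e, 0 < y e) ∧ (∀ e, y e < 1) ∧
      (∀ Z ∈ C, Z ≠ ∅ → Z ≠ E → vs y Z < famRank ℬ Z) ∧ vs y E = famRank ℬ E := by
  obtain ⟨y, h1, h2, h3⟩ := hC.exists_point hr.empty _ E hC.top rfl hE.ne_empty (famRank ℬ E)
    (by linarith) le_rfl
  have hvs : ∀ A ⊆ E, vs (fun e : ↑E => y e) A = ∑ a ∈ A, y a := by
    intro A hA
    exact Finset.sum_congr rfl fun a ha => by simp [ext0, hA ha]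
  refine ⟨fun e => y e, fun e => (h1 e e.2).1, fun e => (h1 e e.2).2, ?_, ?_⟩
  · intro Z hZ h4 h5
    rw [hvs Z (hC.sub Z hZ)]
    exact h3 Z hZ (lt_of_le_of_ne (hC.sub Z hZ) h5) h4
  · rw [hvs E subset_rfl, h2]

theorem mem_relint_chain (hr : RankFn (famRank ℬ)) (hC : GoodChain E (famRank ℬ) C)
    (hE : E.Nonempty) (x : ↑E → ℝ) :
    x ∈ intrinsicInterior ℝ (basePolytope E (chainSchubert E ℬ C)) ↔
      ((∀ e, 0 < x e) ∧ (∀ e, x e < 1) ∧ vs x E = famRank ℬ E) ∧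
      (∀ Z ∈ C, Z ≠ ∅ → Z ≠ E → vs x Z < famRank ℬ Z) := by
  have hr' := chainRank_rankFn hC
  rw [chainSchubert, edmonds hr']
  let l : ↑E ⊕ ↑E ⊕ ↑C ⊕ Unit → (↑E → ℝ) → ℝ := fun i x => match i with
    | .inl e => - x e
    | .inr (.inl e) => x e
    | .inr (.inr (.inl A)) => vs x A
    | .inr (.inr (.inr _)) => - vs x E
  let b : ↑E ⊕ ↑E ⊕ ↑C ⊕ Unit → ℝ := fun i => match i with
    | .inl e => 0
    | .inr (.inl e) => 1
    | .inr (.inr (.inl A)) => famRank ℬ A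
    | .inr (.inr (.inr _)) => - (famRank ℬ E : ℝ)
  have hl : ∀ i, IsLinearMap ℝ (l i) := by
    rintro (e | e | A | u)
    · exact ⟨fun x y => by simp [l]; ring, fun c x => by simp [l]⟩
    · exact ⟨fun x y => by simp [l], fun c x => by simp [l]⟩
    · exact isLinear_vs _
    · exact ⟨fun x y => by simp [l, vs_add]; ring, fun c x => by simp [l, vs_smul]⟩
  have hP : ∀ x, x ∈ Pol E (chainRank ℬ C) ↔ ∀ i, l i x ≤ b i := by
    intro x
    rw [mem_Pol_chain hr hC]
    constructor
    · rintro ⟨h1, h2, h3, h4⟩ (e | e | A | u)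
      · simpa [l, b] using h1 e
      · exact h2 e
      · exact h3 A A.2
      · simp [l, b, h4]
    · intro h
      refine ⟨fun e => by simpa [l, b] using h (.inl e), fun e => h (.inr (.inl e)),
        fun A hA => h (.inr (.inr (.inl ⟨A, hA⟩))), le_antisymm
          (h (.inr (.inr (.inl ⟨E, hC.top⟩)))) ?_⟩
      simpa [l, b] using h (.inr (.inr (.inr ())))
  rw [mem_relint_iff l hl b _ hP]
  obtain ⟨y, hy1, hy2, hy3, hy4⟩ := exists_strict hr hC hE
  have hyP : y ∈ Pol E (chainRank ℬ C) := by
    rw [mem_Pol_chain hr hC]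
    refine ⟨fun e => (hy1 e).le, fun e => (hy2 e).le, fun Z hZ => ?_, hy4⟩
    by_cases h0 : Z = ∅
    · rw [h0, vs_empty]; positivity
    by_cases h1 : Z = E
    · rw [h1, hy4]
    · exact (hy3 Z hZ h0 h1).le
  constructor
  · rintro ⟨h, h'⟩
    refine ⟨⟨fun e => ?_, fun e => ?_, ((mem_Pol_chain hr hC x).1 h).2.2.2⟩, fun Z hZ h0 h1 => ?_⟩
    · rcases h' (.inl e) with h1 | h1
      · simpa [l, b] using h1
      · have := h1 y hyP
        simp only [l, b] at this
        linarith [hy1 e]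
    · rcases h' (.inr (.inl e)) with h1 | h1
      · simpa [l, b] using h1
      · exact absurd (h1 y hyP) (hy2 e).ne
    · rcases h' (.inr (.inr (.inl ⟨Z, hZ⟩))) with h2 | h2
      · simpa [l, b] using h2
      · exact absurd (h2 y hyP) (hy3 Z hZ h0 h1).ne
  · rintro ⟨⟨h1, h2, h3⟩, h4⟩
    refine ⟨(mem_Pol_chain hr hC x).2 ⟨fun e => (h1 e).le, fun e => (h2 e).le, fun Z hZ => ?_, h3⟩,
      ?_⟩
    · by_cases h0 : Z = ∅
      · rw [h0, vs_empty]; positivity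
      by_cases h1 : Z = E
      · rw [h1, h3]
      · exact (h4 Z hZ h0 h1).le
    · rintro (e | e | A | u)
      · left; simpa [l, b] using h1 e
      · left; exact h2 e
      · by_cases h0 : (A : Finset ℕ) = ∅
        · right; intro z _
          simp only [l, b]
          rw [h0, vs_empty, hr.empty]; simp
        by_cases h5 : (A : Finset ℕ) = E
        · right; intro z hz
          simp only [l, b]
          rw [h5]
          exact ((mem_Pol_chain hr hC z).1 hz).2.2.2
        · left; exact h4 A A.2 h0 h5
      · right; intro z hz
        simp only [l, b]
        rw [((mem_Pol_chain hr hC z).1 hz).2.2.2]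

/-- the component of `e` -/
noncomputable def comp (E : Finset ℕ) (ℬ : Finset (Finset ℕ)) (e : ℕ) : Finset ℕ :=
  E.filter fun f => Relation.EqvGen (connRel ℬ) e f

theorem numComponents_eq (E : Finset ℕ) (ℬ : Finset (Finset ℕ)) :
    numComponents E ℬ = (E.image (comp E ℬ)).card := by
  unfold numComponents
  have : {S : Set ℕ | ∃ e ∈ E, S = {f | f ∈ E ∧ Relation.EqvGen (connRel ℬ) e f}} =
      (fun s : Finset ℕ => (s : Set ℕ)) '' (↑(E.image (comp E ℬ)) : Set (Finset ℕ)) := by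
    ext S
    simp only [Set.mem_ofPred_eq, Finset.coe_image, Set.mem_image, Finset.mem_coe,
      exists_exists_and_eq_and, comp, Finset.coe_filter]
    exact exists_congr fun e => and_congr_right fun _ => eq_comm
  rw [this, Set.ncard_image_of_injective _ Finset.coe_injective, Set.ncard_coe_finset]

theorem comp_subset (e : ℕ) : comp E ℬ e ⊆ E := Finset.filter_subset _ _

theorem mem_comp_self {e : ℕ} (he : e ∈ E) : e ∈ comp E ℬ e := by
  simp only [comp, Finset.mem_filter]; exact ⟨he, .refl _⟩

theorem comp_closed {e : ℕ} {r : Finset ℕ → ℕ} (hr : RankFn r) {D : Finset ℕ}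
    (hD : famCircuit (basesOfRank E r) D)
    {a : ℕ} (ha : a ∈ D) (haK : a ∈ comp E (basesOfRank E r) e) :
    D ⊆ comp E (basesOfRank E r) e := by
  intro b hb
  simp only [comp, Finset.mem_filter] at haK ⊢
  refine ⟨?_, haK.2.trans _ _ _ (.rel _ _ (Or.inr ⟨D, hD, ha, hb⟩))⟩
  by_cases hab : a = b
  · rw [← hab]; exact haK.1
  · have := hr.famIndep_iff.1 (hD.2 {b} ⟨by simpa using hb, fun h => hab (by simpa using h ha)⟩)
    exact this.1 (by simp)

theorem comp_separator {e : ℕ} {r : Finset ℕ → ℕ} (hr : RankFn r) :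
    r (comp E (basesOfRank E r) e) + r (E \ comp E (basesOfRank E r) e) = r E :=
  hr.separator_of_closed (comp_subset e) fun _ hD _ ha haK => comp_closed hr hD ha haK

theorem comp_subset_of_separator {r : Finset ℕ → ℕ} (hr : RankFn r) {A : Finset ℕ} (hA : A ⊆ E)
    (h : r A + r (E \ A) = r E) {e : ℕ} (he : e ∈ A) : comp E (basesOfRank E r) e ⊆ A := by
  have key : ∀ a b, Relation.EqvGen (connRel (basesOfRank E r)) a b → (a ∈ A ↔ b ∈ A) := by
    intro a b hab
    induction hab with
    | rel a b h1 =>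
      rcases h1 with rfl | ⟨D, hD, ha, hb⟩
      · rfl
      · exact ⟨fun h2 => hr.closed_of_separator hA h hD ha h2 hb,
          fun h2 => hr.closed_of_separator hA h hD hb h2 ha⟩
    | refl => rfl
    | symm _ _ _ ih => exact ih.symm
    | trans _ _ _ _ _ ih1 ih2 => exact ih1.trans ih2
  intro b hb
  simp only [comp, Finset.mem_filter] at hb
  exact (key e b hb.2).1 he

theorem numComponents_chain (hr : RankFn (famRank ℬ)) (hC : GoodChain E (famRank ℬ) C)
    (hE : E.Nonempty) : numComponents E (chainSchubert E ℬ C) = 1 := by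
  have hr' := chainRank_rankFn hC
  obtain ⟨y, hy1, hy2, hy3, hy4⟩ := exists_strict hr hC hE
  have hyP : y ∈ Pol E (chainRank ℬ C) := by
    rw [mem_Pol_chain hr hC]
    refine ⟨fun e => (hy1 e).le, fun e => (hy2 e).le, fun Z hZ => ?_, hy4⟩
    by_cases h0 : Z = ∅
    · rw [h0, vs_empty]; positivity
    by_cases h1 : Z = E
    · rw [h1, hy4]
    · exact (hy3 Z hZ h0 h1).le
  rw [numComponents_eq, Finset.card_eq_one]
  refine ⟨E, ?_⟩
  have hcomp : ∀ e ∈ E, comp E (chainSchubert E ℬ C) e = E := by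
    intro e he
    unfold chainSchubert
    by_contra hne
    have hsep := comp_separator (E := E) (e := e) hr'
    have hKE : comp E (basesOfRank E (chainRank ℬ C)) e ⊆ E := comp_subset e
    have heK : e ∈ comp E (basesOfRank E (chainRank ℬ C)) e := mem_comp_self he
    set K := comp E (basesOfRank E (chainRank ℬ C)) e
    have h1 := hyP.2.1 _ (Finset.sdiff_subset (s := E) (t := K))
    have h2 := vs_sdiff y hKE
    rw [hyP.2.2, ← hsep] at h2
    push_cast at h2
    have h3 : (chainRank ℬ C K : ℝ) ≤ vs y K := by linarith
    obtain ⟨Z, hZ, e1⟩ := exists_chainRank (ℬ := ℬ) ⟨_, hC.bot⟩ K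
    rw [e1] at h3
    push_cast at h3
    have a1 : vs y K = vs y (K ∩ Z) + vs y (K \ Z) := by
      have := Finset.sum_inter_add_sum_sdiff K Z (ext0 y)
      exact this.symm
    have a3 : vs y (K \ Z) ≤ (K \ Z).card ∧ ((K \ Z).Nonempty → vs y (K \ Z) < (K \ Z).card) := by
      have hlt : ∀ n ∈ K \ Z, ext0 y n < 1 := by
        intro n hn
        rw [ext0_mem y (hKE (Finset.mem_sdiff.1 hn).1)]
        exact hy2 _
      constructor
      · have := Finset.sum_le_card_nsmul (K \ Z) (ext0 y) 1 (fun n hn => (hlt n hn).le)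
        simpa [vs] using this
      · intro hne
        have := Finset.sum_lt_sum_of_nonempty hne hlt
        simpa [vs] using this
    have a4 : vs y (K ∩ Z) ≤ vs y Z := vs_mono (fun e => (hy1 e).le) Finset.inter_subset_right
    by_cases h0 : Z = ∅
    · subst h0
      simp only [Finset.inter_empty, vs_empty, Finset.sdiff_empty, hr.empty] at *
      have := a3.2 ⟨e, heK⟩
      push_cast at h3
      linarith
    by_cases hZE : Z = E
    · subst hZE
      have b1 : vs y K < vs y Z := by
        have := vs_sdiff y hKE
        have hpos : 0 < vs y (Z \ K) := by
          refine Finset.sum_pos ?_ ?_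
          · intro n hn
            rw [ext0_mem y (Finset.mem_sdiff.1 hn).1]
            exact hy1 _
          · rw [Finset.sdiff_nonempty]
            exact fun h => hne (Finset.Subset.antisymm hKE h)
        linarith
      have b2 : (0 : ℝ) ≤ (K \ Z).card := by positivity
      linarith
    · have := hy3 Z hZ h0 hZE
      have := a3.1
      linarith
  ext S
  simp only [Finset.mem_image, Finset.mem_singleton]
  constructor
  · rintro ⟨e, he, rfl⟩; exact hcomp e he
  · rintro rfl
    obtain ⟨e, he⟩ := hE
    exact ⟨e, he, hcomp e he⟩

end chain

/-- signed count of chains -/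
noncomputable def chi {α : Type*} (R : α → α → Prop) (V : Finset α) : ℤ :=
  ∑ D ∈ V.powerset.filter (fun D : Finset α => IsChain R (↑D : Set α)), (-1) ^ D.card

theorem toggle_card {α : Type*} [DecidableEq α] (D : Finset α) (a : α) :
    (-1 : ℤ) ^ (if a ∈ D then D.erase a else insert a D).card = - (-1) ^ D.card := by
  split_ifs with h
  · rw [← Finset.card_erase_add_one h, pow_succ]; ring
  · rw [Finset.card_insert_of_notMem h, pow_succ]; ring

/-- Sign-reversing toggle principle. -/
theorem sum_toggle {α : Type*} [DecidableEq α] (S : Finset (Finset α)) (t : Finset α → α)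
    (hS : ∀ D ∈ S, (if t D ∈ D then D.erase (t D) else insert (t D) D) ∈ S)
    (ht : ∀ D ∈ S, t (if t D ∈ D then D.erase (t D) else insert (t D) D) = t D) :
    ∑ D ∈ S, (-1 : ℤ) ^ D.card = 0 := by
  refine Finset.sum_involution
    (fun D _ => if t D ∈ D then D.erase (t D) else insert (t D) D) ?_ ?_ ?_ ?_
  · intro D hD
    rw [toggle_card]; ring
  · intro D hD _
    split_ifs with h
    · exact fun h' => (Finset.erase_eq_self.1 h') h
    · exact fun h' => h (Finset.insert_eq_self.1 h')
  · intro D hD; exact hS D hD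
  · intro D hD
    have := ht D hD
    rw [this]
    by_cases h : t D ∈ D <;> simp [h]

/-- cone lemma -/
theorem chi_cone {α : Type*} (R : α → α → Prop) (hrefl : ∀ a, R a a)
    (htrans : ∀ a b c, R a b → R b c → R a c)
    (V : Finset α) (p : α) (hp : p ∈ V) (J : α → α)
    (hJ : ∀ z ∈ V, ¬ R p z → J z ∈ V ∧ R z (J z) ∧ R p (J z) ∧
      ∀ y ∈ V, R z y → R p y → R (J z) y) : chi R V = 0 := by
  unfold chi
  let T : Finset α → α := fun S => if h : ∃ m ∈ S, ∀ y ∈ S, R y m then J h.choose else p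
  let F : Finset α → Finset α := fun D => D.filter fun z => ¬ R p z
  have hchainmax : ∀ S : Finset α, IsChain R (↑S : Set α) → S.Nonempty →
      ∃ m ∈ S, ∀ y ∈ S, R y m := by
    intro S
    induction S using Finset.induction_on with
    | empty => simp
    | insert a S ha ih =>
      intro hc _
      by_cases hS : S.Nonempty
      · obtain ⟨m, hm, hm'⟩ := ih (hc.mono (by simp)) hS
        have : R a m ∨ R m a := by
          by_cases h : a = m
          · subst h; exact Or.inl (hrefl _)
          · exact hc (by simp) (by simp [hm]) h
        rcases this with h | h
        · exact ⟨m, by simp [hm], by simpa [h] using hm'⟩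
        · refine ⟨a, by simp, ?_⟩
          intro y hy
          rcases Finset.mem_insert.1 hy with rfl | hy
          · exact hrefl _
          · exact htrans _ _ _ (hm' y hy) h
      · rw [Finset.not_nonempty_iff_eq_empty] at hS
        subst hS
        exact ⟨a, by simp, by simpa using hrefl a⟩
  have hT : ∀ D ⊆ V, IsChain R (↑D : Set α) → T (F D) ∈ V ∧ R p (T (F D)) ∧
      ∀ y ∈ D, R y (T (F D)) ∨ R (T (F D)) y := by
    intro D hD hc
    by_cases h : ∃ m ∈ F D, ∀ y ∈ F D, R y m
    · have hTe : T (F D) = J h.choose := dif_pos h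
      rw [hTe]
      obtain ⟨hm, hm'⟩ := h.choose_spec
      set m := h.choose
      simp only [F, Finset.mem_filter] at hm hm'
      obtain ⟨j1, j2, j3, j4⟩ := hJ m (hD hm.1) hm.2
      refine ⟨j1, j3, fun y hy => ?_⟩
      by_cases hyp : R p y
      · have : R m y ∨ R y m := by
          by_cases hmy : m = y
          · subst hmy; exact Or.inl (hrefl _)
          · exact hc hm.1 hy hmy
        rcases this with h | h
        · exact Or.inr (j4 y (hD hy) h hyp)
        · exact Or.inl (htrans _ _ _ h j2)
      · exact Or.inl (htrans _ _ _ (hm' y ⟨hy, hyp⟩) j2)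
    · have hTe : T (F D) = p := dif_neg h
      rw [hTe]
      refine ⟨hp, hrefl p, fun y hy => Or.inr ?_⟩
      by_contra hyp
      exact h (hchainmax (F D) (hc.mono (by intro z hz; exact (Finset.mem_filter.1 hz).1)) ⟨y, by simp [F, hy, hyp]⟩)
  refine sum_toggle _ (fun D => T (F D)) ?_ ?_
  · intro D hD
    simp only [Finset.mem_filter, Finset.mem_powerset] at hD ⊢
    obtain ⟨h1, h2, h3⟩ := hT D hD.1 hD.2
    split_ifs with h
    · exact ⟨(Finset.erase_subset _ _).trans hD.1, hD.2.mono (by simp)⟩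
    · refine ⟨Finset.insert_subset h1 hD.1, ?_⟩
      rw [Finset.coe_insert]
      exact hD.2.insert fun y hy _ => (h3 y hy).symm
  · intro D hD
    simp only [Finset.mem_filter, Finset.mem_powerset] at hD
    obtain ⟨h1, h2, h3⟩ := hT D hD.1 hD.2
    have : F (if T (F D) ∈ D then D.erase (T (F D)) else insert (T (F D)) D) = F D := by
      ext z
      split_ifs with h
      · simp only [F, Finset.mem_filter, Finset.mem_erase]
        constructor
        · tauto
        · rintro ⟨a, b⟩
          refine ⟨⟨?_, a⟩, b⟩
          rintro rfl; exact b h2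
      · simp only [F, Finset.mem_filter, Finset.mem_insert]
        constructor
        · rintro ⟨rfl | a, b⟩
          · exact absurd h2 b
          · exact ⟨a, b⟩
        · tauto
    simp only [this]

/-- decomposition by maximum -/
theorem chi_max {W : Finset (Finset ℕ)} :
    chi (· ⊆ ·) W = 1 - ∑ Z ∈ W, chi (· ⊆ ·) (W.filter (· ⊂ Z)) := by
  have hsplit : W.powerset.filter (fun D : Finset (Finset ℕ) => IsChain (· ⊆ ·) (↑D : Set (Finset ℕ))) =
      insert ∅ (W.biUnion fun Z => ((W.filter (· ⊂ Z)).powerset.filter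
        (fun D : Finset (Finset ℕ) => IsChain (· ⊆ ·) (↑D : Set (Finset ℕ)))).image (insert Z)) := by
    ext D
    simp only [Finset.mem_filter, Finset.mem_powerset, Finset.mem_insert, Finset.mem_biUnion,
      Finset.mem_image]
    constructor
    · rintro ⟨hD, hc⟩
      by_cases h : D = ∅
      · exact Or.inl h
      right
      obtain ⟨Z, hZ, hmax⟩ := Finset.exists_max_image D Finset.card
        (Finset.nonempty_iff_ne_empty.2 h)
      refine ⟨Z, hD hZ, D.erase Z, ⟨?_, hc.mono (by simp)⟩, Finset.insert_erase hZ⟩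
      intro Y hY
      simp only [Finset.mem_erase] at hY
      simp only [Finset.mem_filter]
      refine ⟨hD hY.2, ?_⟩
      rcases hc.total hY.2 hZ with h1 | h1
      · exact lt_of_le_of_ne h1 hY.1
      · exact absurd (Finset.eq_of_subset_of_card_le h1 (hmax Y hY.2)).symm hY.1
    · rintro (rfl | ⟨Z, hZ, D', ⟨h1, h2⟩, rfl⟩)
      · simp
      · refine ⟨Finset.insert_subset hZ (h1.trans (Finset.filter_subset _ _)), ?_⟩
        rw [Finset.coe_insert]
        refine h2.insert fun y hy _ => Or.inr ?_
        have := h1 hy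
        simp only [Finset.mem_filter] at this
        exact this.2.subset
  have hnotin : ∀ Z, ∀ D ∈ ((W.filter (· ⊂ Z)).powerset.filter
        (fun D : Finset (Finset ℕ) => IsChain (· ⊆ ·) (↑D : Set (Finset ℕ)))), Z ∉ D := by
    intro Z D hD hZ
    simp only [Finset.mem_filter, Finset.mem_powerset] at hD
    have := hD.1 hZ
    simp at this
  have hmaxel : ∀ Z, ∀ D ∈ ((W.filter (· ⊂ Z)).powerset.filter
        (fun D : Finset (Finset ℕ) => IsChain (· ⊆ ·) (↑D : Set (Finset ℕ)))), ∀ Y ∈ insert Z D, Y ⊆ Z := by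
    intro Z D hD Y hY
    simp only [Finset.mem_filter, Finset.mem_powerset] at hD
    rcases Finset.mem_insert.1 hY with rfl | hY
    · exact subset_rfl
    · have := hD.1 hY
      simp only [Finset.mem_filter] at this
      exact this.2.subset
  conv_lhs => unfold chi
  rw [hsplit, Finset.sum_insert, Finset.sum_biUnion]
  · rw [sub_eq_add_neg, ← Finset.sum_neg_distrib]
    simp only [Finset.card_empty, pow_zero]
    congr 1
    refine Finset.sum_congr rfl fun Z hZ => ?_
    rw [Finset.sum_image]
    · unfold chi
      rw [← Finset.sum_neg_distrib]
      refine Finset.sum_congr rfl fun D hD => ?_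
      rw [Finset.card_insert_of_notMem (hnotin Z D hD), pow_succ]; ring
    · intro D hD D' hD' h
      rw [← Finset.erase_insert (hnotin Z D hD), ← Finset.erase_insert (hnotin Z D' hD')]
      rw [h]
  · intro Z hZ Z' hZ' hne
    refine Finset.disjoint_left.2 fun S hS hS' => hne ?_
    simp only [Finset.mem_image] at hS hS'
    obtain ⟨D, hD, rfl⟩ := hS
    obtain ⟨D', hD', h⟩ := hS'
    refine Finset.Subset.antisymm ?_ ?_
    · exact hmaxel Z' D' hD' Z (by rw [h]; simp)
    · exact hmaxel Z D hD Z' (by rw [← h]; simp)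
  · simp

/-- Boolean lattice of unions of blocks. -/
theorem chi_boolean (K : Finset (Finset ℕ)) (W : Finset (Finset ℕ))
    (hne : ∀ k ∈ K, k.Nonempty)
    (hdis : ∀ A ∈ W, ∀ k ∈ K, k ⊆ A ∨ Disjoint k A)
    (hcov : ∀ A ∈ W, A.Nonempty → ∃ k ∈ K, k ⊆ A)
    (hun : ∀ A ∈ W, ∀ k ∈ K, A ∪ k ∈ W) (hsd : ∀ A ∈ W, ∀ k ∈ K, A \ k ∈ W)
    (hdisK : ∀ k ∈ K, ∀ k' ∈ K, k ≠ k' → Disjoint k k') (n : ℕ) :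
    ∀ A ∈ W, A.card = n → A ≠ ∅ →
    chi (· ⊆ ·) (W.filter fun Z => Z ≠ ∅ ∧ Z ⊂ A) = - (-1) ^ (K.filter (· ⊆ A)).card := by
  induction n using Nat.strong_induction_on with
  | _ n ih =>
    intro A hA hn hA0
    rw [chi_max]
    have h1 : ∀ Z ∈ W.filter (fun Z => Z ≠ ∅ ∧ Z ⊂ A),
        chi (· ⊆ ·) ((W.filter fun Z => Z ≠ ∅ ∧ Z ⊂ A).filter (· ⊂ Z)) =
          - (-1) ^ (K.filter (· ⊆ Z)).card := by
      intro Z hZ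
      simp only [Finset.mem_filter] at hZ
      rw [← ih Z.card (by rw [← hn]; exact Finset.card_lt_card hZ.2.2) Z hZ.1 rfl hZ.2.1]
      congr 1
      ext Y
      simp only [Finset.mem_filter]
      constructor
      · tauto
      · rintro ⟨a, b, c⟩
        exact ⟨⟨a, b, c.trans hZ.2.2⟩, c⟩
    rw [Finset.sum_congr rfl h1, Finset.sum_neg_distrib]
    obtain ⟨k, hk, hkA⟩ := hcov A hA (Finset.nonempty_iff_ne_empty.2 hA0)
    -- total sum vanishes
    have hAk := hsd A hA k hk
    have hempty : ∅ ∈ W := by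
      have key : ∀ m, ∀ B ∈ W, B.card = m → ∅ ∈ W := by
        intro m
        induction m using Nat.strong_induction_on with
        | _ m ihm =>
          intro B hB hm
          by_cases hB0 : B = ∅
          · rwa [hB0] at hB
          obtain ⟨k', hk', hk'B⟩ := hcov B hB (Finset.nonempty_iff_ne_empty.2 hB0)
          refine ihm (B \ k').card ?_ (B \ k') (hsd B hB k' hk') rfl
          rw [← hm]
          apply Finset.card_lt_card
          refine ⟨Finset.sdiff_subset, fun h => ?_⟩
          obtain ⟨a, ha⟩ := hne k' hk'
          have := h (hk'B ha)
          simp [ha] at this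
      exact key _ A hA rfl
    have htot : ∑ Z ∈ W.filter (· ⊆ A), (-1 : ℤ) ^ (K.filter (· ⊆ Z)).card = 0 := by
      refine Finset.sum_involution (fun Z _ => if k ⊆ Z then Z \ k else Z ∪ k) ?_ ?_ ?_ ?_
      · intro Z hZ
        simp only [Finset.mem_filter] at hZ
        have hins : ∀ Y ∈ W, Disjoint k Y → (-1 : ℤ) ^ (K.filter (· ⊆ Y)).card
            + (-1 : ℤ) ^ (K.filter (· ⊆ Y ∪ k)).card = 0 := by
          intro Y hY hd
          have : K.filter (· ⊆ Y ∪ k) = insert k (K.filter (· ⊆ Y)) := by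
            ext k'
            simp only [Finset.mem_filter, Finset.mem_insert]
            constructor
            · rintro ⟨a, b⟩
              by_cases hkk : k' = k
              · exact Or.inl hkk
              right
              refine ⟨a, fun z hz => ?_⟩
              rcases Finset.mem_union.1 (b hz) with h | h
              · exact h
              · exact absurd h (Finset.disjoint_left.1 (hdisK k' a k hk hkk) hz)
            · rintro (rfl | ⟨a, b⟩)
              · exact ⟨hk, Finset.subset_union_right⟩
              · exact ⟨a, b.trans Finset.subset_union_left⟩
          rw [this, Finset.card_insert_of_notMem, pow_succ]
          · ring
          · simp only [Finset.mem_filter, not_and]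
            intro _ h
            obtain ⟨a, ha⟩ := hne k hk
            exact Finset.disjoint_left.1 hd ha (h ha)
        split_ifs with h
        · have := hins (Z \ k) (hsd Z hZ.1 k hk) Finset.disjoint_sdiff
          rw [Finset.sdiff_union_of_subset h] at this
          linarith
        · exact hins Z hZ.1 ((hdis Z hZ.1 k hk).resolve_left h)
      · intro Z hZ _
        obtain ⟨a, ha⟩ := hne k hk
        split_ifs with h
        · intro h'
          have := h ha
          rw [← h'] at this
          simp [ha] at this
        · intro h'
          apply h
          rw [← h']
          exact Finset.subset_union_right
      · intro Z hZ
        simp only [Finset.mem_filter] at hZ ⊢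
        split_ifs with h
        · exact ⟨hsd Z hZ.1 k hk, Finset.sdiff_subset.trans hZ.2⟩
        · exact ⟨hun Z hZ.1 k hk, Finset.union_subset hZ.2 hkA⟩
      · intro Z hZ
        simp only [Finset.mem_filter] at hZ
        by_cases h : k ⊆ Z
        · have : ¬ k ⊆ Z \ k := by
            intro h'
            obtain ⟨a, ha⟩ := hne k hk
            have := h' ha
            simp [ha] at this
          simp only [h, this, if_true, if_false]
          exact Finset.sdiff_union_of_subset h
        · have h2 : k ⊆ Z ∪ k := Finset.subset_union_right
          simp only [h, h2, if_true, if_false]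
          rw [Finset.union_sdiff_right]
          exact Finset.sdiff_eq_self_of_disjoint ((hdis Z hZ.1 k hk).resolve_left h).symm
    have hsp : W.filter (· ⊆ A) = insert ∅ (insert A (W.filter fun Z => Z ≠ ∅ ∧ Z ⊂ A)) := by
      ext Z
      simp only [Finset.mem_filter, Finset.mem_insert]
      constructor
      · rintro ⟨a, b⟩
        by_cases h0 : Z = ∅
        · exact Or.inl h0
        by_cases h1 : Z = A
        · exact Or.inr (Or.inl h1)
        · exact Or.inr (Or.inr ⟨a, h0, lt_of_le_of_ne b h1⟩)
      · rintro (rfl | rfl | ⟨a, b, c⟩)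
        · simp [hempty]
        · exact ⟨hA, subset_rfl⟩
        · exact ⟨a, c.subset⟩
    rw [hsp, Finset.sum_insert, Finset.sum_insert] at htot
    · have h0 : K.filter (· ⊆ (∅ : Finset ℕ)) = ∅ := by
        ext k'
        simp only [Finset.mem_filter, Finset.subset_empty, Finset.notMem_empty, iff_false, not_and]
        intro a b
        have := hne k' a
        simp [b] at this
      rw [h0] at htot
      simp only [Finset.card_empty, pow_zero] at htot
      linarith
    · simp
    · simp [Ne.symm hA0]


/-- cyclic flats in rank terms -/
def Cyc (E : Finset ℕ) (r : Finset ℕ → ℕ) (A : Finset ℕ) : Prop :=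
  A ⊆ E ∧ (∀ e ∈ E, r (insert e A) = r A → e ∈ A) ∧ ∀ e ∈ A, r (A.erase e) = r A

/-- the violated or tight proper cyclic flats -/
noncomputable def Vx (E : Finset ℕ) (r : Finset ℕ → ℕ) (x : ↑E → ℝ) : Finset (Finset ℕ) :=
  E.powerset.filter fun A => Cyc E r A ∧ A ≠ ∅ ∧ A ≠ E ∧ (r A : ℝ) ≤ vs x A

/-- closure -/
noncomputable def clo (E : Finset ℕ) (r : Finset ℕ → ℕ) (A : Finset ℕ) : Finset ℕ :=
  E.filter fun e => r (insert e A) = r A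

theorem subset_clo {E : Finset ℕ} {r : Finset ℕ → ℕ} {A : Finset ℕ} (hA : A ⊆ E) :
    A ⊆ clo E r A := by
  intro e he
  simp only [clo, Finset.mem_filter]
  exact ⟨hA he, by rw [Finset.insert_eq_of_mem he]⟩

theorem r_clo {E : Finset ℕ} {r : Finset ℕ → ℕ} (hr : RankFn r) {A : Finset ℕ} (hA : A ⊆ E) :
    r (clo E r A) = r A := by
  have := hr.eq_of_insert (J := A) (clo E r A) (fun e he => by
    simp only [clo, Finset.mem_filter] at he
    exact he.2.le)
  rwa [Finset.union_eq_right.2 (subset_clo hA)] at this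

theorem clo_subset_flat {E : Finset ℕ} {r : Finset ℕ → ℕ} (hr : RankFn r) {A y : Finset ℕ}
    (hAy : A ⊆ y) (hy : ∀ e ∈ E, r (insert e y) = r y → e ∈ y) : clo E r A ⊆ y := by
  intro e he
  simp only [clo, Finset.mem_filter] at he
  refine hy e he.1 (le_antisymm ?_ (hr.mono (Finset.subset_insert _ _)))
  have h1 := hr.submod (insert e A) y
  have h2 : insert e A ∪ y = insert e y := by
    rw [Finset.insert_union, Finset.union_eq_right.2 hAy]
  have h3 : r A ≤ r (insert e A ∩ y) :=
    hr.mono (Finset.subset_inter (Finset.subset_insert _ _) hAy)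
  rw [h2, he.2] at h1
  omega

theorem erase_mono {r : Finset ℕ → ℕ} (hr : RankFn r) {S T : Finset ℕ} (h : S ⊆ T) {e : ℕ}
    (he : e ∈ S) (hS : r (S.erase e) = r S) : r (T.erase e) = r T := by
  refine le_antisymm (hr.mono (Finset.erase_subset _ _)) ?_
  have h1 := hr.submod S (T.erase e)
  have h2 : S ∪ T.erase e = T := by
    ext a
    simp only [Finset.mem_union, Finset.mem_erase]
    constructor
    · rintro (a1 | a1)
      · exact h a1
      · exact a1.2
    · intro ha
      by_cases hae : a = e
      · subst hae; exact Or.inl he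
      · exact Or.inr ⟨hae, ha⟩
  have h3 : S ∩ T.erase e = S.erase e := by
    ext a
    simp only [Finset.mem_inter, Finset.mem_erase]
    constructor
    · tauto
    · intro ha; exact ⟨ha.2, ha.1, h ha.2⟩
  rw [h2, h3] at h1
  omega

theorem cyc_clo {E : Finset ℕ} {r : Finset ℕ → ℕ} (hr : RankFn r) {z p : Finset ℕ}
    (hz : Cyc E r z) (hp : Cyc E r p) : Cyc E r (clo E r (z ∪ p)) := by
  have hA : z ∪ p ⊆ E := Finset.union_subset hz.1 hp.1
  have hrc := r_clo hr hA
  have hsub := subset_clo (r := r) hA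
  refine ⟨Finset.filter_subset _ _, fun e he h => ?_, fun e he => ?_⟩
  · simp only [clo, Finset.mem_filter]
    refine ⟨he, le_antisymm ?_ (hr.mono (Finset.subset_insert _ _))⟩
    rw [← hrc, ← h]
    exact hr.mono (Finset.insert_subset_insert _ hsub)
  · by_cases h1 : e ∈ z
    · exact erase_mono hr (Finset.subset_union_left.trans hsub) h1 (hz.2.2 e h1)
    by_cases h2 : e ∈ p
    · exact erase_mono hr (Finset.subset_union_right.trans hsub) h2 (hp.2.2 e h2)
    refine le_antisymm (hr.mono (Finset.erase_subset _ _)) ?_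
    rw [hrc]
    refine hr.mono fun a ha => Finset.mem_erase.2 ⟨?_, hsub ha⟩
    rintro rfl
    rcases Finset.mem_union.1 ha with h | h
    · exact h1 h
    · exact h2 h

section
variable {E : Finset ℕ} {r : Finset ℕ → ℕ}

theorem cyc_of_min (hr : RankFn r) {x : ↑E → ℝ} (h0 : ∀ e, 0 < x e) (h1 : ∀ e, x e < 1)
    {A : Finset ℕ} (hA : A ⊆ E)
    (hmin : ∀ B ⊆ E, (r A : ℝ) - vs x A ≤ r B - vs x B) : Cyc E r A := by
  refine ⟨hA, fun e he h => ?_, fun e he => ?_⟩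
  · by_contra hn
    have h2 := hmin (insert e A) (Finset.insert_subset he hA)
    have h3 := vs_insert x ⟨e, he⟩ hn
    have h4 := h0 ⟨e, he⟩
    simp only at h3
    rw [h3, h] at h2
    linarith
  · by_contra hn
    have h2 := hmin (A.erase e) ((Finset.erase_subset _ _).trans hA)
    have h3 := vs_erase x ⟨e, hA he⟩ he
    have h4 := h1 ⟨e, hA he⟩
    have h5 : r (A.erase e) + 1 ≤ r A :=
      lt_of_le_of_ne (hr.mono (Finset.erase_subset _ _)) hn
    have h6 : (r (A.erase e) : ℝ) + 1 ≤ r A := by exact_mod_cast h5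
    simp only at h3
    linarith

theorem f_submod (hr : RankFn r) (x : ↑E → ℝ) (A B : Finset ℕ) :
    ((r (A ∪ B) : ℝ) - vs x (A ∪ B)) + ((r (A ∩ B) : ℝ) - vs x (A ∩ B)) ≤
      (r A - vs x A) + (r B - vs x B) := by
  have h1 := vs_union_inter x A B
  have h2 : (r (A ∪ B) : ℝ) + r (A ∩ B) ≤ r A + r B := by exact_mod_cast hr.submod A B
  linarith

/-- the point is outside the polytope -/
theorem chi_outside (hr : RankFn r) {x : ↑E → ℝ} (h0 : ∀ e, 0 < x e) (h1 : ∀ e, x e < 1)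
    (hE : vs x E = r E) (hout : ∃ A ⊆ E, (r A : ℝ) < vs x A) :
    chi (· ⊆ ·) (Vx E r x) = 0 := by
  obtain ⟨A1, hA1, hA1'⟩ := hout
  obtain ⟨m, hm, hmin⟩ := Finset.exists_min_image E.powerset (fun A => (r A : ℝ) - vs x A)
    ⟨∅, by simp⟩
  obtain ⟨p, hp, hpmin⟩ := Finset.exists_min_image
    (E.powerset.filter fun A => ∀ B ⊆ E, (r A : ℝ) - vs x A ≤ r B - vs x B) Finset.card
    ⟨m, by
      simp only [Finset.mem_filter]
      exact ⟨hm, fun B hB => hmin B (Finset.mem_powerset.2 hB)⟩⟩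
  simp only [Finset.mem_filter, Finset.mem_powerset] at hp hpmin
  obtain ⟨hpE, hpm⟩ := hp
  have hpneg : (r p : ℝ) - vs x p < 0 := by have := hpm A1 hA1; linarith
  have hpc : Cyc E r p := cyc_of_min hr h0 h1 hpE hpm
  have hleast : ∀ B ⊆ E, (r B : ℝ) - vs x B ≤ r p - vs x p → p ⊆ B := by
    intro B hB hB'
    have h2 := f_submod hr x p B
    have h3 := hpm (p ∪ B) (Finset.union_subset hpE hB)
    have h4 := hpmin (p ∩ B) ⟨Finset.inter_subset_left.trans hpE, fun B' hB' => by
      have := hpm B' hB'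
      linarith⟩
    have h5 := Finset.eq_of_subset_of_card_le Finset.inter_subset_left h4
    rw [← h5]; exact Finset.inter_subset_right
  have hp0 : p ≠ ∅ := by
    rintro rfl
    rw [hr.empty, vs_empty] at hpneg; simp at hpneg
  refine chi_cone _ (fun _ => subset_rfl) (fun a b c => Finset.Subset.trans) _ p ?_
    (fun z => clo E r (z ∪ p)) ?_
  · simp only [Vx, Finset.mem_filter, Finset.mem_powerset]
    refine ⟨hpE, hpc, hp0, ?_, by linarith⟩
    rintro rfl
    rw [hE] at hpneg; simp at hpneg
  · intro z hz hpz
    simp only [Vx, Finset.mem_filter, Finset.mem_powerset] at hz ⊢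
    obtain ⟨hzE, hzc, hz0, hz1, hz2⟩ := hz
    have hA : z ∪ p ⊆ E := Finset.union_subset hzE hpE
    have hsub := subset_clo (r := r) hA
    have hcc := cyc_clo hr hzc hpc
    have hs := f_submod hr x z p
    have hi := hpm (z ∩ p) (Finset.inter_subset_left.trans hzE)
    have hmono := vs_mono (fun e => (h0 e).le) hsub
    have hrc := r_clo hr hA
    have hpsub : p ⊆ clo E r (z ∪ p) := Finset.subset_union_right.trans hsub
    refine ⟨⟨hcc.1, hcc, ?_, ?_, ?_⟩, Finset.subset_union_left.trans hsub, hpsub, ?_⟩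
    · intro h
      rw [h] at hpsub
      exact hp0 (Finset.subset_empty.1 hpsub)
    · intro h
      rw [h] at hmono hrc
      rw [← hrc] at hs
      exact hpz ((hleast (z ∩ p) (Finset.inter_subset_left.trans hzE) (by linarith)).trans
        Finset.inter_subset_left)
    · rw [hrc]; linarith
    · intro y hy hzy hpy
      exact clo_subset_flat hr (Finset.union_subset hzy hpy) hy.2.1.2.1

theorem tight_union (hr : RankFn r) {x : ↑E → ℝ} (h : ∀ A ⊆ E, vs x A ≤ r A) {A B : Finset ℕ}
    (hA : A ⊆ E) (hB : B ⊆ E) (h1 : vs x A = r A) (h2 : vs x B = r B) :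
    vs x (A ∪ B) = r (A ∪ B) := by
  have h3 := f_submod hr x A B
  have h4 := h _ (Finset.union_subset hA hB)
  have h5 := h (A ∩ B) (Finset.inter_subset_left.trans hA)
  linarith

/-- tight sets -/
noncomputable def Wx (E : Finset ℕ) (r : Finset ℕ → ℕ) (x : ↑E → ℝ) : Finset (Finset ℕ) :=
  E.powerset.filter fun A => vs x A = r A

theorem mem_Wx {x : ↑E → ℝ} {A : Finset ℕ} : A ∈ Wx E r x ↔ A ⊆ E ∧ vs x A = r A := by
  simp [Wx]

theorem Vx_eq (hr : RankFn r) {x : ↑E → ℝ} (h0 : ∀ e, 0 < x e) (h1 : ∀ e, x e < 1)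
    (hin : ∀ A ⊆ E, vs x A ≤ r A) :
    Vx E r x = (Wx E r x).filter fun Z => Z ≠ ∅ ∧ Z ⊂ E := by
  ext Z
  simp only [Vx, Finset.mem_filter, Finset.mem_powerset, mem_Wx]
  constructor
  · rintro ⟨a, b, c, d, e⟩
    exact ⟨⟨a, le_antisymm (hin Z a) e⟩, c, lt_of_le_of_ne a d⟩
  · rintro ⟨⟨a, b⟩, c, d⟩
    refine ⟨a, cyc_of_min hr h0 h1 a fun B hB => ?_, c, d.ne, b.ge⟩
    have := hin B hB
    linarith

/-- interior case -/
theorem chi_inside (hr : RankFn r) {x : ↑E → ℝ} (h0 : ∀ e, 0 < x e) (h1 : ∀ e, x e < 1)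
    (hE : vs x E = r E) (hne : E ≠ ∅) (hin : ∀ A ⊆ E, vs x A ≤ r A)
    (hsep : ∀ A ⊆ E, vs x A = r A → r A + r (E \ A) = r E) :
    chi (· ⊆ ·) (Vx E r x) = - (-1) ^ numComponents E (basesOfRank E r) := by
  rw [Vx_eq hr h0 h1 hin, numComponents_eq]
  have hsymm : ∀ A ⊆ E, r A + r (E \ A) = r E → r (E \ A) + r (E \ (E \ A)) = r E := by
    intro A hA h
    rw [Finset.sdiff_sdiff_eq_self hA]; omega
  have hdis : ∀ A ∈ Wx E r x, ∀ k ∈ E.image (comp E (basesOfRank E r)),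
      k ⊆ A ∨ Disjoint k A := by
    intro A hA k hk
    rw [mem_Wx] at hA
    obtain ⟨e, he, rfl⟩ := Finset.mem_image.1 hk
    have hs := hsep A hA.1 hA.2
    by_cases hea : e ∈ A
    · exact Or.inl (comp_subset_of_separator hr hA.1 hs hea)
    · right
      have := comp_subset_of_separator hr (A := E \ A) Finset.sdiff_subset (hsymm A hA.1 hs)
        (Finset.mem_sdiff.2 ⟨he, hea⟩)
      exact Finset.disjoint_of_subset_left this Finset.sdiff_disjoint
  have htight : ∀ k ∈ E.image (comp E (basesOfRank E r)), k ∈ Wx E r x ∧ E \ k ∈ Wx E r x := by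
    intro k hk
    obtain ⟨e, he, rfl⟩ := Finset.mem_image.1 hk
    have hs := comp_separator (E := E) (e := e) hr
    have hk := comp_subset (E := E) (ℬ := basesOfRank E r) e
    have h2 := vs_sdiff x hk
    have h3 := hin _ hk
    have h4 := hin (E \ comp E (basesOfRank E r) e) Finset.sdiff_subset
    have h5 : (r (comp E (basesOfRank E r) e) : ℝ) + r (E \ comp E (basesOfRank E r) e) = r E := by
      exact_mod_cast hs
    rw [mem_Wx, mem_Wx]
    exact ⟨⟨hk, by linarith⟩, ⟨Finset.sdiff_subset, by linarith⟩⟩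
  rw [chi_boolean (E.image (comp E (basesOfRank E r))) (Wx E r x) ?_ hdis ?_ ?_ ?_ ?_ E.card E
    (mem_Wx.2 ⟨subset_rfl, hE⟩) rfl hne]
  · congr 3
    apply Finset.filter_true_of_mem
    intro k hk
    exact (mem_Wx.1 (htight k hk).1).1
  · intro k hk
    obtain ⟨e, he, rfl⟩ := Finset.mem_image.1 hk
    exact ⟨e, mem_comp_self he⟩
  · intro A hA hA0
    rw [mem_Wx] at hA
    obtain ⟨a, ha⟩ := hA0
    exact ⟨_, Finset.mem_image_of_mem _ (hA.1 ha),
      comp_subset_of_separator hr hA.1 (hsep A hA.1 hA.2) ha⟩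
  · intro A hA k hk
    have := (htight k hk).1
    rw [mem_Wx] at hA this ⊢
    exact ⟨Finset.union_subset hA.1 this.1, tight_union hr hin hA.1 this.1 hA.2 this.2⟩
  · intro A hA k hk
    have := (htight k hk).2
    rw [mem_Wx] at hA this ⊢
    have h2 : A \ k = A ∩ (E \ k) := by
      ext a
      simp only [Finset.mem_sdiff, Finset.mem_inter]
      constructor
      · rintro ⟨a1, a2⟩; exact ⟨a1, hA.1 a1, a2⟩
      · tauto
    rw [h2]
    exact ⟨Finset.inter_subset_left.trans hA.1, tight_inter hr hin hA.1 this.1 hA.2 this.2⟩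
  · intro k hk k' hk' hkk
    rcases hdis k' (htight k' hk').1 k hk with h | h
    · rcases hdis k (htight k hk).1 k' hk' with h' | h'
      · exact absurd (Finset.Subset.antisymm h h') hkk
      · exact h'.symm
    · exact h

theorem chi_symm (V : Finset (Finset ℕ)) :
    chi (fun a b : Finset ℕ => b ⊆ a) V = chi (· ⊆ ·) V := by
  unfold chi
  congr 1
  refine Finset.filter_congr fun D _ => ?_
  constructor
  · intro h a ha b hb hab; exact (h ha hb hab).symm
  · intro h a ha b hb hab; exact (h ha hb hab).symm

/-- boundary case -/
theorem chi_boundary (hr : RankFn r) {x : ↑E → ℝ} (h0 : ∀ e, 0 < x e) (h1 : ∀ e, x e < 1)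
    (hE : vs x E = r E) (hne : E ≠ ∅) (hin : ∀ A ⊆ E, vs x A ≤ r A)
    (hsep : ∃ A ⊆ E, vs x A = r A ∧ r A + r (E \ A) ≠ r E) :
    chi (· ⊆ ·) (Vx E r x) = 0 := by
  rw [Vx_eq hr h0 h1 hin, ← chi_symm]
  obtain ⟨A0, hA0, hA0t, hA0s⟩ := hsep
  have hatom : ∀ Z ∈ Wx E r x, Z ≠ ∅ → ∃ Y ∈ Wx E r x, Y ≠ ∅ ∧ Y ⊆ Z ∧
      ∀ Y' ∈ Wx E r x, Y' ⊆ Y → Y' ≠ ∅ → Y' = Y := by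
    intro Z hZ hZ0
    obtain ⟨Y, hY, hmin⟩ := Finset.exists_min_image
      ((Wx E r x).filter fun Y => Y ≠ ∅ ∧ Y ⊆ Z) Finset.card ⟨Z, by simp [hZ, hZ0]⟩
    simp only [Finset.mem_filter] at hY hmin
    refine ⟨Y, hY.1, hY.2.1, hY.2.2, fun Y' h2 h3 h4 => ?_⟩
    exact Finset.eq_of_subset_of_card_le h3 (hmin Y' ⟨h2, h4, h3.trans hY.2.2⟩)
  have hinter : ∀ A ∈ Wx E r x, ∀ B ∈ Wx E r x, A ∩ B ∈ Wx E r x := by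
    intro A hA B hB
    rw [mem_Wx] at *
    exact ⟨Finset.inter_subset_left.trans hA.1, tight_inter hr hin hA.1 hB.1 hA.2 hB.2⟩
  have hsup : ∀ N ⊆ Wx E r x, N.biUnion id ∈ Wx E r x := by
    intro N
    induction N using Finset.induction_on with
    | empty => intro _; rw [mem_Wx]; simp [vs_empty, hr.empty]
    | insert a N ha ih =>
      intro hN
      have h2 := ih ((Finset.subset_insert _ _).trans hN)
      have h3 := hN (Finset.mem_insert_self _ _)
      rw [Finset.biUnion_insert]
      rw [mem_Wx] at *
      exact ⟨Finset.union_subset h3.1 h2.1, tight_union hr hin h3.1 h2.1 h3.2 h2.2⟩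
  let N := (Wx E r x).filter fun Y => Y ≠ ∅ ∧ ∀ Y' ∈ Wx E r x, Y' ⊆ Y → Y' ≠ ∅ → Y' = Y
  have hNW : N ⊆ Wx E r x := Finset.filter_subset _ _
  let Q := N.biUnion id
  have hQ : Q ∈ Wx E r x := hsup N hNW
  have hQat : ∀ Z ∈ Wx E r x, Z ≠ ∅ → Z ∩ Q ≠ ∅ := by
    intro Z hZ hZ0 h
    obtain ⟨Y, hY, hY0, hYZ, hYm⟩ := hatom Z hZ hZ0
    have hYQ : Y ⊆ Q := Finset.subset_biUnion_of_mem id (Finset.mem_filter.2 ⟨hY, hY0, hYm⟩)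
    have := Finset.subset_inter hYZ hYQ
    rw [h] at this
    exact hY0 (Finset.subset_empty.1 this)
  have hEW : E ∈ Wx E r x := mem_Wx.2 ⟨subset_rfl, hE⟩
  have hQ0 : Q ≠ ∅ := by
    intro h
    exact hQat E hEW hne (by rw [h]; simp)
  have hQE : Q ≠ E := by
    intro h
    apply hA0s
    have h2 := hsup (N.filter fun Y => Disjoint Y A0) ((Finset.filter_subset _ _).trans hNW)
    have h3 : (N.filter fun Y => Disjoint Y A0).biUnion id = E \ A0 := by
      ext e
      simp only [Finset.mem_biUnion, Finset.mem_filter, id, Finset.mem_sdiff]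
      constructor
      · rintro ⟨Y, ⟨hY, hd⟩, he⟩
        exact ⟨(mem_Wx.1 (hNW hY)).1 he, Finset.disjoint_left.1 hd he⟩
      · rintro ⟨heE, heA⟩
        rw [← h] at heE
        obtain ⟨Y, hY, he⟩ := Finset.mem_biUnion.1 heE
        refine ⟨Y, ⟨hY, ?_⟩, he⟩
        rw [Finset.disjoint_iff_inter_eq_empty]
        by_contra hcon
        have h4 := (Finset.mem_filter.1 hY).2.2 (Y ∩ A0)
          (hinter Y (hNW hY) A0 (mem_Wx.2 ⟨hA0, hA0t⟩)) Finset.inter_subset_left hcon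
        have h5 : e ∈ Y ∩ A0 := by rw [h4]; exact he
        exact heA (Finset.mem_inter.1 h5).2
    rw [h3] at h2
    have h4 := (mem_Wx.1 h2).2
    have h5 := vs_sdiff x hA0
    have h6 : (r A0 : ℝ) + r (E \ A0) = r E := by linarith
    exact_mod_cast h6
  refine chi_cone (fun a b : Finset ℕ => b ⊆ a) (fun _ => subset_rfl) (fun a b c h h' => Finset.Subset.trans h' h) _ Q ?_
    (fun z => z ∩ Q) ?_
  · simp only [Finset.mem_filter]
    exact ⟨hQ, hQ0, lt_of_le_of_ne (mem_Wx.1 hQ).1 hQE⟩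
  · intro z hz _
    simp only [Finset.mem_filter] at hz ⊢
    refine ⟨⟨hinter z hz.1 Q hQ, hQat z hz.1 hz.2.1, ?_⟩, Finset.inter_subset_left,
      Finset.inter_subset_right, fun y _ a b => Finset.subset_inter a b⟩
    exact lt_of_le_of_lt (Finset.inter_subset_left) hz.2.2

end

section final
variable {E : Finset ℕ} {ℬ : Finset (Finset ℕ)}

theorem mem_cyclicFlats (hM : IsBasisFamily E ℬ) {A : Finset ℕ} :
    A ∈ cyclicFlats E ℬ ↔ Cyc E (famRank ℬ) A := by
  simp only [cyclicFlats, Finset.mem_filter, Finset.mem_powerset, isCyclicFlat_iff hM, Cyc]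
  tauto

theorem rank_single (hM : IsBasisFamily E ℬ) (hl : ∀ e ∈ E, ∃ B ∈ ℬ, e ∈ B) :
    ∀ e ∈ E, famRank ℬ {e} = 1 := by
  intro e he
  obtain ⟨B, hB, heB⟩ := hl e he
  have h1 := le_famRank hB {e}
  have h2 := (famRank_rankFn hM).le_card {e}
  rw [Finset.inter_eq_left.2 (by simpa using heB)] at h1
  simp only [Finset.card_singleton] at h1 h2
  omega

theorem rank_erase (hM : IsBasisFamily E ℬ) (hc : ∀ e ∈ E, ∃ B ∈ ℬ, e ∉ B) :
    ∀ e ∈ E, famRank ℬ (E.erase e) = famRank ℬ E := by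
  intro e he
  obtain ⟨B, hB, heB⟩ := hc e he
  have h1 := le_famRank hB (E.erase e)
  have h2 := (famRank_rankFn hM).mono (Finset.erase_subset e E)
  have h3 := famRank_ground hM hB
  rw [Finset.inter_eq_right.2 (Finset.subset_erase.2 ⟨hM.2.1 B hB, heB⟩)] at h1
  omega

theorem cyc_empty (hM : IsBasisFamily E ℬ) (hl : ∀ e ∈ E, ∃ B ∈ ℬ, e ∈ B) :
    Cyc E (famRank ℬ) ∅ := by
  refine ⟨by simp, fun e he h => ?_, by simp⟩
  have := rank_single hM hl e he
  rw [(famRank_rankFn hM).empty] at h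
  simp only [insert_empty_eq] at h
  omega

theorem cyc_ground (hM : IsBasisFamily E ℬ) (hc : ∀ e ∈ E, ∃ B ∈ ℬ, e ∉ B) :
    Cyc E (famRank ℬ) E :=
  ⟨subset_rfl, fun e he _ => he, rank_erase hM hc⟩

theorem mem_cyclicChains (hM : IsBasisFamily E ℬ) (hl : ∀ e ∈ E, ∃ B ∈ ℬ, e ∈ B)
    (hc : ∀ e ∈ E, ∃ B ∈ ℬ, e ∉ B) {C : Finset (Finset ℕ)} :
    C ∈ cyclicChains E ℬ ↔ (∀ Z ∈ C, Cyc E (famRank ℬ) Z) ∧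
      IsChain (· ⊆ ·) (↑C : Set (Finset ℕ)) ∧ ∅ ∈ C ∧ E ∈ C := by
  simp only [cyclicChains, Finset.mem_filter, Finset.mem_powerset, IsCyclicChain]
  constructor
  · rintro ⟨h1, h2, h3, ⟨F, hF, hF'⟩, ⟨G, hG, hG'⟩⟩
    refine ⟨fun Z hZ => (mem_cyclicFlats hM).1 (h1 hZ), h3, ?_, ?_⟩
    · have := hF' ∅ ((mem_cyclicFlats hM).2 (cyc_empty hM hl))
      rwa [Finset.subset_empty.1 this] at hF
    · have := hG' E ((mem_cyclicFlats hM).2 (cyc_ground hM hc))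
      have h4 := ((mem_cyclicFlats hM).1 (h1 hG)).1
      rwa [Finset.Subset.antisymm h4 this] at hG
  · rintro ⟨h1, h2, h3, h4⟩
    have h5 : C ⊆ cyclicFlats E ℬ := fun Z hZ => (mem_cyclicFlats hM).2 (h1 Z hZ)
    exact ⟨h5, by exact_mod_cast h5, h2, ⟨∅, h3, fun G _ => by simp⟩,
      ⟨E, h4, fun G hG => ((mem_cyclicFlats hM).1 hG).1⟩⟩

theorem goodChain (hM : IsBasisFamily E ℬ) (hl : ∀ e ∈ E, ∃ B ∈ ℬ, e ∈ B)
    (hc : ∀ e ∈ E, ∃ B ∈ ℬ, e ∉ B) {C : Finset (Finset ℕ)} (hC : C ∈ cyclicChains E ℬ) :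
    GoodChain E (famRank ℬ) C := by
  rw [mem_cyclicChains hM hl hc] at hC
  obtain ⟨h1, h2, h3, h4⟩ := hC
  have hr := famRank_rankFn hM
  refine ⟨fun Z hZ => (h1 Z hZ).1, h2, h3, h4, fun Z hZ Z' hZ' h => ?_, fun Z hZ Z' hZ' h => ?_⟩
  · obtain ⟨e, he, heZ⟩ := Finset.exists_of_ssubset h
    have h5 := hr.mono (Finset.subset_insert e Z)
    have h6 := hr.mono (Finset.insert_subset he h.subset)
    rcases eq_or_ne (famRank ℬ (insert e Z)) (famRank ℬ Z) with h7 | h7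
    · exact absurd ((h1 Z hZ).2.1 e ((h1 Z' hZ').1 he) h7) heZ
    · omega
  · obtain ⟨e, he, heZ⟩ := Finset.exists_of_ssubset h
    have h5 := (h1 Z' hZ').2.2 e he
    have h6 := hr.le_add_card_sdiff Z (Z'.erase e)
    have h7 : Z ⊆ Z'.erase e := Finset.subset_erase.2 ⟨h.subset, heZ⟩
    have h8 := Finset.card_sdiff_add_card_eq_card h7
    have h9 := Finset.card_erase_add_one he
    omega

theorem pow_sdiff {C D : Finset (Finset ℕ)} (h : C ⊆ D) :
    (-1 : ℤ) ^ (D \ C).card = (-1) ^ D.card * (-1) ^ C.card := by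
  rw [← Finset.card_sdiff_add_card_eq_card h, pow_add, mul_assoc, ← pow_add, ← two_mul]
  simp

theorem mu_eq (hM : IsBasisFamily E ℬ) (hl : ∀ e ∈ E, ∃ B ∈ ℬ, e ∈ B)
    (hc : ∀ e ∈ E, ∃ B ∈ ℬ, e ∉ B)
    (mu : Finset (Finset ℕ) → Finset (Finset ℕ) → ℤ)
    (hrefl : ∀ C ∈ cyclicChains E ℬ, mu C C = 1)
    (hrec : ∀ C ∈ cyclicChains E ℬ, ∀ D ∈ cyclicChains E ℬ, C ⊂ D →
      ∑ z ∈ (cyclicChains E ℬ).filter (fun z => C ⊆ z ∧ z ⊆ D), mu C z = 0)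
    {C : Finset (Finset ℕ)} (hC : C ∈ cyclicChains E ℬ) (n : ℕ) :
    ∀ D ∈ cyclicChains E ℬ, C ⊆ D → D.card = n → mu C D = (-1) ^ D.card * (-1) ^ C.card := by
  induction n using Nat.strong_induction_on with
  | _ n ih =>
    intro D hD hCD hn
    by_cases hCD' : C = D
    · subst hCD'
      rw [hrefl C hC, ← pow_add, ← two_mul]; simp
    have hss : C ⊂ D := lt_of_le_of_ne hCD hCD'
    have h1 := hrec C hC D hD hss
    obtain ⟨e, heD, heC⟩ := Finset.exists_of_ssubset hss
    have hmem : ∀ z, C ⊆ z → z ⊆ D → z ∈ cyclicChains E ℬ := by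
      intro z h2 h3
      rw [mem_cyclicChains hM hl hc] at *
      exact ⟨fun Z hZ => hD.1 Z (h3 hZ), hD.2.1.mono (by exact_mod_cast h3), h2 hC.2.2.1,
        h2 hC.2.2.2⟩
    have h2 : ∑ z ∈ (cyclicChains E ℬ).filter (fun z => C ⊆ z ∧ z ⊆ D), (-1 : ℤ) ^ z.card = 0 := by
      refine sum_toggle _ (fun _ => e) ?_ (fun _ _ => rfl)
      intro z hz
      simp only [Finset.mem_filter] at hz ⊢
      obtain ⟨-, hz1, hz2⟩ := hz
      have : C ⊆ (if e ∈ z then z.erase e else insert e z) ∧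
          (if e ∈ z then z.erase e else insert e z) ⊆ D := by
        split_ifs
        · exact ⟨Finset.subset_erase.2 ⟨hz1, heC⟩, (Finset.erase_subset _ _).trans hz2⟩
        · exact ⟨hz1.trans (Finset.subset_insert _ _), Finset.insert_subset heD hz2⟩
      exact ⟨hmem _ this.1 this.2, this⟩
    have hDm : D ∈ (cyclicChains E ℬ).filter (fun z => C ⊆ z ∧ z ⊆ D) := by
      simp [hD, hCD]
    rw [← Finset.add_sum_erase _ _ hDm] at h1 h2
    have h3 : ∑ z ∈ ((cyclicChains E ℬ).filter (fun z => C ⊆ z ∧ z ⊆ D)).erase D, mu C z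
        = (∑ z ∈ ((cyclicChains E ℬ).filter (fun z => C ⊆ z ∧ z ⊆ D)).erase D,
          (-1 : ℤ) ^ z.card) * (-1) ^ C.card := by
      rw [Finset.sum_mul]
      refine Finset.sum_congr rfl fun z hz => ?_
      simp only [Finset.mem_erase, Finset.mem_filter] at hz
      refine ih z.card ?_ z hz.2.1 hz.2.2.1 rfl
      rw [← hn]
      exact Finset.card_lt_card (lt_of_le_of_ne hz.2.2.2 hz.1)
    rw [h3] at h1
    have h4 : (∑ z ∈ ((cyclicChains E ℬ).filter (fun z => C ⊆ z ∧ z ⊆ D)).erase D,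
          (-1 : ℤ) ^ z.card) = - (-1) ^ D.card := by linarith
    rw [h4] at h1
    linarith

theorem chain_sum (hM : IsBasisFamily E ℬ) (hl : ∀ e ∈ E, ∃ B ∈ ℬ, e ∈ B)
    (hc : ∀ e ∈ E, ∃ B ∈ ℬ, e ∉ B) (hE : E ≠ ∅) (x : ↑E → ℝ) :
    ∑ C ∈ (cyclicChains E ℬ).filter
        (fun C => ∀ Z ∈ C, Z ≠ ∅ → Z ≠ E → vs x Z < famRank ℬ Z),
      ∑ D ∈ (cyclicChains E ℬ).filter (fun D => C ⊆ D), (-1 : ℤ) ^ D.card * (-1) ^ C.card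
      = chi (· ⊆ ·) (Vx E (famRank ℬ) x) := by
  have hmem := @mem_cyclicChains E ℬ hM hl hc
  have hswap : ∑ C ∈ (cyclicChains E ℬ).filter
        (fun C => ∀ Z ∈ C, Z ≠ ∅ → Z ≠ E → vs x Z < famRank ℬ Z),
      ∑ D ∈ (cyclicChains E ℬ).filter (fun D => C ⊆ D), (-1 : ℤ) ^ D.card * (-1) ^ C.card
      = ∑ D ∈ cyclicChains E ℬ, ∑ C ∈ (cyclicChains E ℬ).filter
        (fun C => (∀ Z ∈ C, Z ≠ ∅ → Z ≠ E → vs x Z < famRank ℬ Z) ∧ C ⊆ D),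
        (-1 : ℤ) ^ D.card * (-1) ^ C.card := by
    refine Finset.sum_comm' fun C D => ?_
    simp only [Finset.mem_filter]; tauto
  rw [hswap]
  have hpair : ({∅, E} : Finset (Finset ℕ)) ∈ cyclicChains E ℬ := by
    rw [hmem]
    refine ⟨?_, ?_, by simp, by simp⟩
    · intro Z hZ
      simp only [Finset.mem_insert, Finset.mem_singleton] at hZ
      rcases hZ with rfl | rfl
      · exact cyc_empty hM hl
      · exact cyc_ground hM hc
    · intro a ha b hb _
      simp only [Finset.coe_insert, Finset.coe_singleton, Set.mem_insert_iff,
        Set.mem_singleton_iff] at ha hb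
      rcases ha with rfl | rfl <;> rcases hb with rfl | rfl <;> simp
  have hinner : ∀ D ∈ cyclicChains E ℬ, ∑ C ∈ (cyclicChains E ℬ).filter
        (fun C => (∀ Z ∈ C, Z ≠ ∅ → Z ≠ E → vs x Z < famRank ℬ Z) ∧ C ⊆ D),
        (-1 : ℤ) ^ D.card * (-1) ^ C.card =
      if ∀ Z ∈ D, Z ≠ ∅ → Z ≠ E → (famRank ℬ Z : ℝ) ≤ vs x Z then (-1) ^ D.card else 0 := by
    intro D hD
    rw [← Finset.mul_sum]
    have hD' := hmem.1 hD
    split_ifs with h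
    · have : (cyclicChains E ℬ).filter
        (fun C => (∀ Z ∈ C, Z ≠ ∅ → Z ≠ E → vs x Z < famRank ℬ Z) ∧ C ⊆ D) = {{∅, E}} := by
        ext C
        simp only [Finset.mem_filter, Finset.mem_singleton]
        constructor
        · rintro ⟨h1, h2, h3⟩
          have h1' := hmem.1 h1
          ext Z
          simp only [Finset.mem_insert, Finset.mem_singleton]
          constructor
          · intro hZ
            by_contra hcon
            rw [not_or] at hcon
            exact absurd (h2 Z hZ hcon.1 hcon.2) (not_lt.2 (h Z (h3 hZ) hcon.1 hcon.2))
          · rintro (rfl | rfl)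
            · exact h1'.2.2.1
            · exact h1'.2.2.2
        · rintro rfl
          refine ⟨hpair, ?_, ?_⟩
          · intro Z hZ a b
            simp only [Finset.mem_insert, Finset.mem_singleton] at hZ
            tauto
          · intro Z hZ
            simp only [Finset.mem_insert, Finset.mem_singleton] at hZ
            rcases hZ with rfl | rfl
            · exact hD'.2.2.1
            · exact hD'.2.2.2
      rw [this, Finset.sum_singleton, Finset.card_pair (Ne.symm hE)]
      simp
    · simp only [not_forall, not_le] at h
      obtain ⟨Z0, hZ0, hZ1, hZ2, hZ3⟩ := h
      rw [sum_toggle _ (fun _ => Z0) ?_ (fun _ _ => rfl), mul_zero]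
      intro C hC
      simp only [Finset.mem_filter, hmem] at hC ⊢
      obtain ⟨⟨c1, c2, c3, c4⟩, c5, c6⟩ := hC
      split_ifs with h
      · have hs : C.erase Z0 ⊆ C := Finset.erase_subset _ _
        refine ⟨⟨fun Z hZ => c1 Z (hs hZ), c2.mono (by exact_mod_cast hs), ?_, ?_⟩,
          fun Z hZ => c5 Z (hs hZ), hs.trans c6⟩
        · simp [c3, Ne.symm hZ1]
        · simp [c4, Ne.symm hZ2]
      · have hs : insert Z0 C ⊆ D := Finset.insert_subset hZ0 c6
        refine ⟨⟨fun Z hZ => hD'.1 Z (hs hZ), hD'.2.1.mono (by exact_mod_cast hs),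
          by simp [c3], by simp [c4]⟩, ?_, hs⟩
        intro Z hZ
        rcases Finset.mem_insert.1 hZ with rfl | hZ
        · intro _ _; exact hZ3
        · exact c5 Z hZ
  rw [Finset.sum_congr rfl hinner, ← Finset.sum_filter]
  unfold chi
  have hVm : ∀ Z, Z ∈ Vx E (famRank ℬ) x ↔ Cyc E (famRank ℬ) Z ∧ Z ≠ ∅ ∧ Z ≠ E ∧
      (famRank ℬ Z : ℝ) ≤ vs x Z := by
    intro Z
    simp only [Vx, Finset.mem_filter, Finset.mem_powerset, and_iff_right_iff_imp]
    exact fun h => h.1.1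
  refine Finset.sum_nbij' (fun D => (D.erase ∅).erase E) (fun D => insert E (insert ∅ D))
    ?_ ?_ ?_ ?_ ?_
  · intro D hD
    simp only [Finset.mem_filter, hmem, Finset.mem_powerset] at hD ⊢
    obtain ⟨⟨d1, d2, d3, d4⟩, d5⟩ := hD
    have hs : (D.erase ∅).erase E ⊆ D := (Finset.erase_subset _ _).trans (Finset.erase_subset _ _)
    refine ⟨fun Z hZ => ?_, d2.mono (by exact_mod_cast hs)⟩
    have hZD := hs hZ
    simp only [Finset.mem_erase] at hZ
    rw [hVm]
    exact ⟨d1 Z hZD, hZ.2.1, hZ.1, d5 Z hZD hZ.2.1 hZ.1⟩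
  · intro D hD
    simp only [Finset.mem_filter, hmem, Finset.mem_powerset] at hD ⊢
    obtain ⟨d1, d2⟩ := hD
    refine ⟨⟨?_, ?_, by simp, by simp⟩, ?_⟩
    · intro Z hZ
      simp only [Finset.mem_insert] at hZ
      rcases hZ with rfl | rfl | hZ
      · exact cyc_ground hM hc
      · exact cyc_empty hM hl
      · exact ((hVm Z).1 (d1 hZ)).1
    · rw [Finset.coe_insert, Finset.coe_insert]
      refine (d2.insert fun b _ _ => Or.inl (Finset.empty_subset b)).insert fun b hb _ => Or.inr ?_
      rcases hb with rfl | hb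
      · exact Finset.empty_subset _
      · exact ((hVm b).1 (d1 hb)).1.1
    · intro Z hZ h1 h2
      simp only [Finset.mem_insert] at hZ
      exact ((hVm Z).1 (d1 (by tauto))).2.2.2
  · intro D hD
    simp only [Finset.mem_filter, hmem] at hD
    obtain ⟨⟨d1, d2, d3, d4⟩, d5⟩ := hD
    ext Z
    simp only [Finset.mem_insert, Finset.mem_erase]
    constructor
    · rintro (rfl | rfl | h)
      · exact d4
      · exact d3
      · exact h.2.2
    · tauto
  · intro D hD
    simp only [Finset.mem_filter, Finset.mem_powerset] at hD
    ext Z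
    simp only [Finset.mem_insert, Finset.mem_erase]
    constructor
    · tauto
    · intro h
      have := (hVm Z).1 (hD.1 h)
      tauto
  · intro D hD
    simp only [Finset.mem_filter, hmem] at hD
    obtain ⟨⟨d1, d2, d3, d4⟩, d5⟩ := hD
    have h1 := Finset.card_erase_add_one d3
    have h2 := Finset.card_erase_add_one (Finset.mem_erase.2 ⟨hE, d4⟩ : E ∈ D.erase ∅)
    rw [← h1, ← h2, pow_add, pow_add]; ring

theorem sign_eq (c : ℕ) : (((c : ℤ) - (1 : ℕ)).negOnePow : ℤ) = - (-1) ^ c := by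
  have : ((c : ℤ) - (1 : ℕ)) = c - 1 := by simp
  rw [this, Int.negOnePow_sub, Int.negOnePow_one]
  rw [Int.negOnePow_def]; simp

end final

theorem basesOfRank_empty (r : Finset ℕ → ℕ) (h : r ∅ = 0) : basesOfRank ∅ r = {∅} := by
  ext B
  simp only [basesOfRank, Finset.powerset_empty, Finset.mem_filter, Finset.mem_singleton]
  constructor
  · exact fun h => h.1
  · rintro rfl; simp [h]

/-- Let `M` be a matroid on a finite ground set `E` with no loops and no
coloops. Then, as functions `ℝ^E → ℤ`, the indicator function of the relative interior of
`P(M)` equals the sum, over all chains `C` in the lattice of cyclic flats of `M`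
containing its minimum and maximum, of `(−1)^{c(M) − c(S_C)} · λ_C` times the indicator
function of the relative interior of `P(S_C)`, where `λ_C = −μ(C, 1̂)` and `μ` is the
Möbius function of the cyclic chain lattice of `M` (characterized here by `μ(x, x) = 1`
and `Σ_{x ≤ z ≤ y} μ(x, z) = 0` for `x < y`, with `μ(C, 1̂)` recorded in `muTop C`). -/
theorem statement8 (E : Finset ℕ) (ℬ : Finset (Finset ℕ)) (hM : IsBasisFamily E ℬ)
    (hloopless : ∀ e ∈ E, ∃ B ∈ ℬ, e ∈ B)
    (hcoloopless : ∀ e ∈ E, ∃ B ∈ ℬ, e ∉ B)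
    (mu : Finset (Finset ℕ) → Finset (Finset ℕ) → ℤ) (muTop : Finset (Finset ℕ) → ℤ)
    (hrefl : ∀ C ∈ cyclicChains E ℬ, mu C C = 1)
    (hrec : ∀ C ∈ cyclicChains E ℬ, ∀ D ∈ cyclicChains E ℬ, C ⊂ D →
      ∑ z ∈ (cyclicChains E ℬ).filter (fun z => C ⊆ z ∧ z ⊆ D), mu C z = 0)
    (htop : ∀ C ∈ cyclicChains E ℬ,
      (∑ z ∈ (cyclicChains E ℬ).filter (fun z => C ⊆ z), mu C z) + muTop C = 0) :
    relintInd E ℬ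
      = fun x => ∑ C ∈ cyclicChains E ℬ,
          (((numComponents E ℬ : ℤ)
              - (numComponents E (chainSchubert E ℬ C) : ℤ)).negOnePow : ℤ)
            * (-(muTop C)) * relintInd E (chainSchubert E ℬ C) x := by
  have hr := famRank_rankFn hM
  have hmem := @mem_cyclicChains E ℬ hM hloopless hcoloopless
  funext x
  by_cases hE : E = ∅
  · subst hE
    have hCC : cyclicChains ∅ ℬ = {{∅}} := by
      ext C
      rw [hmem, Finset.mem_singleton]
      constructor
      · rintro ⟨h1, -, h2, -⟩
        ext Z
        rw [Finset.mem_singleton]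
        constructor
        · intro hZ; exact Finset.subset_empty.1 (h1 Z hZ).1
        · rintro rfl; exact h2
      · rintro rfl
        refine ⟨?_, ?_, by simp, by simp⟩
        · intro Z hZ
          rw [Finset.mem_singleton.1 hZ]
          exact cyc_empty hM hloopless
        · simp
    have h1 : chainSchubert ∅ ℬ {∅} = ℬ := by
      conv_rhs => rw [← basesOfRank_famRank hM]
      rw [chainSchubert, basesOfRank_empty _ hr.empty, basesOfRank_empty]
      simp [chainRank, hr.empty]
    have h2 := htop {∅} (by rw [hCC]; simp)
    have h3 := hrefl {∅} (by rw [hCC]; simp)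
    rw [hCC] at h2 ⊢
    rw [Finset.filter_true_of_mem (by simp), Finset.sum_singleton, h3] at h2
    have h4 : muTop {∅} = -1 := by linarith
    rw [Finset.sum_singleton, h1, h4]
    simp
  have hEn : E.Nonempty := Finset.nonempty_iff_ne_empty.2 hE
  have hgood := fun C (hC : C ∈ cyclicChains E ℬ) => goodChain hM hloopless hcoloopless hC
  have hmt : ∀ C ∈ cyclicChains E ℬ, -(muTop C) =
      ∑ D ∈ (cyclicChains E ℬ).filter (fun D => C ⊆ D), (-1 : ℤ) ^ D.card * (-1) ^ C.card := by
    intro C hC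
    have h1 := htop C hC
    have h2 : ∑ z ∈ (cyclicChains E ℬ).filter (fun z => C ⊆ z), mu C z =
        ∑ D ∈ (cyclicChains E ℬ).filter (fun D => C ⊆ D), (-1 : ℤ) ^ D.card * (-1) ^ C.card := by
      refine Finset.sum_congr rfl fun D hD => ?_
      rw [Finset.mem_filter] at hD
      exact mu_eq hM hloopless hcoloopless mu hrefl hrec hC _ D hD.1 hD.2 rfl
    linarith
  have hsing := rank_single hM hloopless
  have hLHS : relintInd E ℬ x = if x ∈ Pol E (famRank ℬ) ∧ (∀ e, 0 < x e) ∧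
      ∀ A ⊆ E, vs x A = famRank ℬ A → famRank ℬ A + famRank ℬ (E \ A) = famRank ℬ E
      then 1 else 0 := by
    unfold relintInd
    have hP : basePolytope E ℬ = Pol E (famRank ℬ) := by
      rw [← edmonds hr, basesOfRank_famRank hM]
    rw [hP]
    exact if_congr (mem_relint_Pol hr hsing x) rfl rfl
  by_cases hx : (∀ e, 0 < x e) ∧ (∀ e, x e < 1) ∧ vs x E = famRank ℬ E
  · have hRHS : (∑ C ∈ cyclicChains E ℬ,
          (((numComponents E ℬ : ℤ)
              - (numComponents E (chainSchubert E ℬ C) : ℤ)).negOnePow : ℤ)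
            * (-(muTop C)) * relintInd E (chainSchubert E ℬ C) x) =
        - (-1) ^ numComponents E ℬ * chi (· ⊆ ·) (Vx E (famRank ℬ) x) := by
      rw [← chain_sum hM hloopless hcoloopless hE x, Finset.sum_filter, Finset.mul_sum]
      refine Finset.sum_congr rfl fun C hC => ?_
      rw [numComponents_chain hr (hgood C hC) hEn, sign_eq, hmt C hC]
      have : relintInd E (chainSchubert E ℬ C) x =
          if ∀ Z ∈ C, Z ≠ ∅ → Z ≠ E → vs x Z < famRank ℬ Z then 1 else 0 := by
        unfold relintInd
        refine if_congr ?_ rfl rfl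
        rw [mem_relint_chain hr (hgood C hC) hEn]
        exact and_iff_right hx
      rw [this]
      split_ifs <;> ring
    rw [hRHS, hLHS]
    obtain ⟨h0, h1, h2⟩ := hx
    by_cases hin : ∀ A ⊆ E, vs x A ≤ famRank ℬ A
    · by_cases hsep : ∀ A ⊆ E, vs x A = famRank ℬ A →
        famRank ℬ A + famRank ℬ (E \ A) = famRank ℬ E
      · rw [if_pos ⟨⟨fun e => (h0 e).le, hin, h2⟩, h0, hsep⟩,
          chi_inside hr h0 h1 h2 hE hin hsep, basesOfRank_famRank hM, neg_mul_neg, ← pow_add,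
          ← two_mul]
        simp
      · rw [if_neg (fun h => hsep h.2.2), chi_boundary hr h0 h1 h2 hE hin, mul_zero]
        simp only [not_forall] at hsep
        obtain ⟨A, a, b, c⟩ := hsep
        exact ⟨A, a, b, c⟩
    · rw [if_neg (fun h => hin h.1.2.1), chi_outside hr h0 h1 h2, mul_zero]
      simp only [not_forall, not_le] at hin
      obtain ⟨A, a, b⟩ := hin
      exact ⟨A, a, b⟩
  · rw [Finset.sum_eq_zero, hLHS, if_neg]
    · rintro ⟨h1, h2, h3⟩
      refine hx ⟨h2, fun e => lt_of_le_of_ne (Pol_le_one hr h1 e) fun h => ?_, h1.2.2⟩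
      have h4 := h3 {(e : ℕ)} (by simp) (by rw [vs_singleton, h, hsing e e.2]; simp)
      have h5 := rank_erase hM hcoloopless e e.2
      rw [hsing e e.2, Finset.sdiff_singleton_eq_erase] at h4
      omega
    · intro C hC
      have : relintInd E (chainSchubert E ℬ C) x = 0 := by
        unfold relintInd
        rw [if_neg]
        rw [mem_relint_chain hr (hgood C hC) hEn]
        exact fun h => hx h.1
      rw [this, mul_zero]


end GPoly
end

section
/- Let r ≥ 2 and let Cat_r = SM({1, 3, 5, …, 2r−1}) be the Catalan matroid of rank r on [2r]. Then, in ℚ[t], the sum over all bases B of Cat_r with e(B) = 1 and i(B) = 0 of t^{α(B)} equals the Narayana polynomial Σ_{k=0}^{r−2} (1/(r−1)) · C(r−1, k) · C(r−1, k+1) · t^k. -/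
open scoped Classical

namespace GPoly

/-- Number of elements of `B` that are at most `k`. -/
def cnt (B : Finset ℕ) (k : ℕ) : ℕ := (B.filter (fun x => x ≤ k)).card

lemma cnt_emb (r : ℕ) (B : Finset ℕ) (hB : B.card = r) (i : Fin r) :
    cnt B (B.orderEmbOfFin hB i) = i + 1 := by
  have h : B.filter (fun x => x ≤ B.orderEmbOfFin hB i)
      = (Finset.Iic i).map (B.orderEmbOfFin hB).toEmbedding := by
    ext x
    simp only [Finset.mem_filter, Finset.mem_map, Finset.mem_Iic]
    constructor
    · rintro ⟨hx, hle⟩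
      have : x ∈ Set.range (B.orderEmbOfFin hB) := by
        rw [Finset.range_orderEmbOfFin]; exact hx
      obtain ⟨j, rfl⟩ := this
      exact ⟨j, by simpa using hle, rfl⟩
    · rintro ⟨j, hj, rfl⟩
      refine ⟨Finset.orderEmbOfFin_mem B hB j, ?_⟩
      simpa using hj
  unfold cnt
  rw [h, Finset.card_map, Fin.card_Iic]

lemma gale_iff (r : ℕ) (B : Finset ℕ) (hB : B.card = r) :
    galeLe ((Finset.range r).image fun k => 2 * k + 1) B ↔ ∀ k, 2 * cnt B k ≤ k + 1 := by
  have hs : ((Finset.range r).image fun k => 2 * k + 1).sort (· ≤ ·)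
      = (List.range r).map (fun k => 2 * k + 1) := by
    have hn : ((List.range r).map (fun k => 2 * k + 1)).Nodup := by
      apply List.Nodup.map _ List.nodup_range
      intro a b h; simpa using h
    have := (List.toFinset_sort (· ≤ ·) hn).2 (by
      rw [List.pairwise_map]
      exact List.pairwise_lt_range.imp (by intro a b h; omega))
    rw [← this]
    congr 1
  have h1 : galeLe ((Finset.range r).image fun k => 2 * k + 1) B ↔
      ∀ i : Fin r, 2 * (i : ℕ) + 1 ≤ B.orderEmbOfFin hB i := by
    unfold galeLe
    rw [hs, List.forall₂_iff_get]
    constructor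
    · rintro ⟨_, h⟩ i
      have := h i (by simp) (by simp [hB])
      simpa [Finset.orderEmbOfFin_apply] using this
    · intro h
      refine ⟨by simp [hB], ?_⟩
      intro i h1 h2
      have := h ⟨i, by simpa using h1⟩
      simpa [Finset.orderEmbOfFin_apply] using this
  rw [h1]
  constructor
  · intro h k
    by_contra hk
    push Not at hk
    have hle : cnt B k ≤ r := by
      rw [← hB]; exact Finset.card_le_card (Finset.filter_subset _ _)
    set i : Fin r := ⟨cnt B k - 1, by omega⟩ with hi
    have h2 := h i
    have h3 := cnt_emb r B hB i
    have hiv : (i : ℕ) = cnt B k - 1 := rfl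
    have h4 : k < B.orderEmbOfFin hB i := by omega
    have h5 : cnt B k < cnt B (B.orderEmbOfFin hB i) := by
      apply Finset.card_lt_card
      rw [Finset.ssubset_iff_of_subset]
      · refine ⟨B.orderEmbOfFin hB i, ?_, ?_⟩
        · simp [Finset.orderEmbOfFin_mem]
        · simp [h4]
      · intro x hx
        simp only [Finset.mem_filter] at hx ⊢
        exact ⟨hx.1, by omega⟩
    omega
  · intro h i
    have := h (B.orderEmbOfFin hB i)
    rw [cnt_emb] at this
    omega

/-- The bases of the Catalan matroid. -/
noncomputable abbrev catB (r : ℕ) : Finset (Finset ℕ) :=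
  schubertBases (2 * r) r ((Finset.range r).image fun k => 2 * k + 1)

lemma mem_catB (r : ℕ) (B : Finset ℕ) :
    B ∈ catB r ↔ B ⊆ Finset.Icc 1 (2 * r) ∧ B.card = r ∧ ∀ k, 2 * cnt B k ≤ k + 1 := by
  unfold catB schubertBases
  rw [Finset.mem_filter, Finset.mem_powerset]
  constructor
  · rintro ⟨h1, h2, h3⟩
    exact ⟨h1, h2, (gale_iff r B h2).1 h3⟩
  · rintro ⟨h1, h2, h3⟩
    exact ⟨h1, h2, (gale_iff r B h2).2 h3⟩

lemma cnt_erase (B : Finset ℕ) (b k : ℕ) (hb : b ∈ B) :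
    cnt (B.erase b) k + (if b ≤ k then 1 else 0) = cnt B k := by
  unfold cnt
  rw [Finset.filter_erase]
  split_ifs with h
  · rw [Finset.card_erase_add_one]; simp [hb, h]
  · rw [Finset.erase_eq_of_notMem (by simp [h])]; rfl

lemma cnt_insert (B : Finset ℕ) (b k : ℕ) (hb : b ∉ B) :
    cnt (insert b B) k = cnt B k + (if b ≤ k then 1 else 0) := by
  unfold cnt
  rw [Finset.filter_insert]
  split_ifs with h
  · rw [Finset.card_insert_of_notMem]; simp [hb]
  · rfl

lemma cnt_swap (B : Finset ℕ) (b e k : ℕ) (hb : b ∈ B) (he : e ∉ B) :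
    cnt (insert e (B.erase b)) k + (if b ≤ k then 1 else 0)
      = cnt B k + (if e ≤ k then 1 else 0) := by
  rw [cnt_insert _ _ _ (by simp [he]), ← cnt_erase B b k hb]; omega

lemma card_swap (B : Finset ℕ) (b e : ℕ) (hb : b ∈ B) (he : e ∉ B) :
    (insert e (B.erase b)).card = B.card := by
  rw [Finset.card_insert_of_notMem (by simp [he]), Finset.card_erase_add_one hb]

lemma cnt_mono (B : Finset ℕ) {j k : ℕ} (h : j ≤ k) : cnt B j ≤ cnt B k := by
  apply Finset.card_le_card
  intro x hx
  simp only [Finset.mem_filter] at hx ⊢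
  exact ⟨hx.1, by omega⟩

lemma cnt_succ (B : Finset ℕ) (k : ℕ) :
    cnt B (k + 1) = cnt B k + (if k + 1 ∈ B then 1 else 0) := by
  unfold cnt
  split_ifs with h
  · have : B.filter (fun x => x ≤ k + 1) = insert (k + 1) (B.filter (fun x => x ≤ k)) := by
      ext x; simp only [Finset.mem_filter, Finset.mem_insert]
      constructor
      · rintro ⟨h1, h2⟩
        by_cases hx : x = k + 1
        · exact Or.inl hx
        · exact Or.inr ⟨h1, by omega⟩
      · rintro (rfl | ⟨h1, h2⟩)
        · exact ⟨h, le_rfl⟩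
        · exact ⟨h1, by omega⟩
    rw [this, Finset.card_insert_of_notMem]
    simp
  · congr 1
    ext x; simp only [Finset.mem_filter]
    constructor
    · rintro ⟨h1, h2⟩
      refine ⟨h1, ?_⟩
      by_contra hx
      have : x = k + 1 := by omega
      exact h (this ▸ h1)
    · rintro ⟨h1, h2⟩
      exact ⟨h1, by omega⟩

lemma exists_circuit (ℬ : Finset (Finset ℕ)) (S : Finset ℕ) (h : ¬ famIndep ℬ S) :
    ∃ C ⊆ S, famCircuit ℬ C := by
  induction S using Finset.strongInduction with
  | H S ih =>
    by_cases hS : ∀ C' ⊂ S, famIndep ℬ C'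
    · exact ⟨S, subset_rfl, h, hS⟩
    · push Not at hS
      obtain ⟨T, hT, hTi⟩ := hS
      obtain ⟨C, hC, hCC⟩ := ih T hT hTi
      exact ⟨C, hC.trans hT.subset, hCC⟩

lemma extActive_iff (r : ℕ) (B : Finset ℕ) (hB : B ∈ catB r) (e : ℕ) :
    ExtActive (Finset.Icc 1 (2 * r)) (catB r) B e ↔
      e ∈ Finset.Icc 1 (2 * r) ∧ ∀ x ∈ B, e < x := by
  have hB' := (mem_catB r B).1 hB
  constructor
  · rintro ⟨he, heB, C, hC, hcirc, heC, hmin⟩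
    refine ⟨he, ?_⟩
    intro b hb
    by_contra hbe
    have hne : b ≠ e := fun h => heB (h ▸ hb)
    apply hcirc.1
    refine ⟨insert e (B.erase b), ?_, ?_⟩
    · rw [mem_catB]
      refine ⟨?_, ?_, ?_⟩
      · intro x hx
        rcases Finset.mem_insert.1 hx with rfl | hx
        · exact he
        · exact hB'.1 (Finset.mem_of_mem_erase hx)
      · rw [card_swap B b e hb heB]; exact hB'.2.1
      · intro k
        have h1 := cnt_swap B b e k hb heB
        have h2 := hB'.2.2 k
        split_ifs at h1 <;> omega
    · intro x hx
      rcases Finset.mem_insert.1 (hC hx) with rfl | hxB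
      · simp
      · have := hmin x hx
        simp only [Finset.mem_insert, Finset.mem_erase]
        right; exact ⟨by omega, hxB⟩
  · rintro ⟨he, hlt⟩
    have heB : e ∉ B := fun h => lt_irrefl _ (hlt e h)
    refine ⟨he, heB, ?_⟩
    obtain ⟨C, hC, hcirc⟩ := exists_circuit (catB r) (insert e B) (by
      rintro ⟨B2, hB2, hs⟩
      have h1 := Finset.card_le_card hs
      rw [Finset.card_insert_of_notMem heB, ((mem_catB r B2).1 hB2).2.1, hB'.2.1] at h1
      omega)
    refine ⟨C, hC, hcirc, ?_, ?_⟩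
    · by_contra heC
      apply hcirc.1
      refine ⟨B, hB, ?_⟩
      intro x hx
      rcases Finset.mem_insert.1 (hC hx) with rfl | h
      · exact absurd hx heC
      · exact h
    · intro x hx
      rcases Finset.mem_insert.1 (hC hx) with rfl | h
      · exact le_rfl
      · exact (hlt x h).le

lemma extAct_eq_one_iff (r : ℕ) (hr : 2 ≤ r) (B : Finset ℕ) (hB : B ∈ catB r) :
    extAct (Finset.Icc 1 (2 * r)) (catB r) B = 1 ↔ 1 ∉ B ∧ 2 ∈ B := by
  have hB' := (mem_catB r B).1 hB
  have hf : (Finset.Icc 1 (2 * r)).filter (ExtActive (Finset.Icc 1 (2 * r)) (catB r) B)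
      = (Finset.Icc 1 (2 * r)).filter (fun e => ∀ x ∈ B, e < x) := by
    apply Finset.filter_congr
    intro e he
    rw [extActive_iff r B hB]
    simp only [he, true_and]
  unfold extAct
  rw [hf]
  constructor
  · intro h
    obtain ⟨a, ha⟩ := Finset.card_eq_one.1 h
    have hmem : ∀ e, e ∈ Finset.Icc 1 (2 * r) ∧ (∀ x ∈ B, e < x) ↔ e = a := by
      intro e
      have : e ∈ (Finset.Icc 1 (2 * r)).filter (fun e => ∀ x ∈ B, e < x) ↔ e = a := by
        rw [ha, Finset.mem_singleton]
      rwa [Finset.mem_filter] at this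
    have h1 := (hmem a).2 rfl
    have ha1 : 1 = a := by
      apply (hmem 1).1
      refine ⟨by simp; omega, fun x hx => ?_⟩
      have := h1.2 x hx
      have := (Finset.mem_Icc.1 h1.1).1
      omega
    subst ha1
    refine ⟨fun h => lt_irrefl _ (h1.2 1 h), ?_⟩
    by_contra h2
    have : 2 = 1 := by
      apply (hmem 2).1
      refine ⟨by simp; omega, fun x hx => ?_⟩
      have := h1.2 x hx
      have : x ≠ 2 := fun h => h2 (h ▸ hx)
      omega
    omega
  · rintro ⟨h1, h2⟩
    rw [Finset.card_eq_one]
    refine ⟨1, ?_⟩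
    ext e
    simp only [Finset.mem_filter, Finset.mem_Icc, Finset.mem_singleton]
    constructor
    · rintro ⟨⟨h3, h4⟩, h5⟩
      have := h5 2 h2
      omega
    · rintro rfl
      refine ⟨⟨le_rfl, by omega⟩, fun x hx => ?_⟩
      have := Finset.mem_Icc.1 (hB'.1 hx)
      have : x ≠ 1 := fun h => h1 (h ▸ hx)
      omega

/-- If `[k+1, i]` is contained in `B` then the counting function grows with slope one. -/
lemma cnt_run (B : Finset ℕ) (k d : ℕ) (h : ∀ j, k < j → j ≤ k + d → j ∈ B) :
    cnt B (k + d) = cnt B k + d := by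
  induction d with
  | zero => rfl
  | succ d ih =>
    rw [← add_assoc, cnt_succ, ih (fun j h1 h2 => h j h1 (by omega)),
      if_pos (h _ (by omega) (by omega))]
    omega

lemma intAct_eq_zero_iff (r : ℕ) (B : Finset ℕ) (hB : B ∈ catB r) :
    intAct (Finset.Icc 1 (2 * r)) (catB r) B = 0 ↔ ∀ k, 2 * cnt B k ≤ k := by
  have hB' := (mem_catB r B).1 hB
  unfold intAct
  rw [Finset.card_eq_zero, Finset.filter_eq_empty_iff]
  constructor
  · intro hno k
    by_contra hk
    push Not at hk
    have hk2 := hB'.2.2 k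
    have h0 : cnt B 0 = 0 := by
      have := hB'.2.2 0
      omega
    obtain ⟨m, rfl⟩ : ∃ m, k = m + 1 := by
      cases k with
      | zero => omega
      | succ m => exact ⟨m, rfl⟩
    have hm := hB'.2.2 m
    have hs := cnt_succ B m
    have hiB : m + 1 ∈ B := by
      by_contra hni
      rw [if_neg hni] at hs
      omega
    refine hno (hB'.1 hiB) ⟨hiB, ?_⟩
    set E := Finset.Icc 1 (2 * r) with hE
    obtain ⟨C, hC, hcirc⟩ := exists_circuit (famDual E (catB r))
      ((insert (m + 1) (E \ B)).filter (fun x => m + 1 ≤ x)) (by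
        rintro ⟨D, hD, hs2⟩
        unfold famDual at hD
        obtain ⟨B2, hB2, rfl⟩ := Finset.mem_image.1 hD
        have hB2' := (mem_catB r B2).1 hB2
        have h1 := hB2'.2.2 m
        have hsub : B2.filter (fun x => ¬ x ≤ m) ⊆ B.filter (fun x => ¬ x ≤ m + 1) := by
          intro x hx
          simp only [Finset.mem_filter] at hx ⊢
          have hxn : x ∉ (insert (m + 1) (E \ B)).filter (fun x => m + 1 ≤ x) := by
            intro hxx
            exact (Finset.mem_sdiff.1 (hs2 hxx)).2 hx.1
          simp only [Finset.mem_filter, Finset.mem_insert, Finset.mem_sdiff] at hxn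
          have hxE := hB2'.1 hx.1
          constructor
          · by_contra hxB
            exact hxn ⟨Or.inr ⟨hxE, hxB⟩, by omega⟩
          · intro hle
            exact hxn ⟨Or.inl (by omega), by omega⟩
        have h2 := Finset.card_le_card hsub
        have h3 := Finset.card_filter_add_card_filter_not (s := B2) (fun x => x ≤ m)
        have h4 := Finset.card_filter_add_card_filter_not (s := B) (fun x => x ≤ m + 1)
        have e1 := hB'.2.1
        have e2 := hB2'.2.1
        unfold cnt at h1 hk
        omega)
    refine ⟨C, hC.trans (Finset.filter_subset _ _), hcirc, ?_, ?_⟩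
    · by_contra hiC
      apply hcirc.1
      refine ⟨E \ B, Finset.mem_image_of_mem _ hB, ?_⟩
      intro x hx
      have := (Finset.mem_filter.1 (hC hx)).1
      rcases Finset.mem_insert.1 this with rfl | h
      · exact absurd hx hiC
      · exact h
    · intro x hx
      exact (Finset.mem_filter.1 (hC hx)).2
  · rintro hD i hi ⟨hiB, C, hC, hcirc, hiC, hmin⟩
    have h1B : 1 ∉ B := by
      intro h1
      have := hD 1
      have hp : 0 < cnt B 1 := Finset.card_pos.2 ⟨1, by simp [h1]⟩
      omega
    have hi1 := Finset.mem_Icc.1 hi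
    have hine : i ≠ 1 := fun h => h1B (h ▸ hiB)
    have hne : ((Finset.Icc 1 i).filter (fun x => x ∉ B)).Nonempty :=
      ⟨1, by simp [h1B]; omega⟩
    obtain ⟨x, hx, hxmax⟩ := Finset.exists_max_image _ (fun x => x) hne
    simp only [Finset.mem_filter, Finset.mem_Icc] at hx hxmax
    have hxi : x ≠ i := fun h => hx.2 (h ▸ hiB)
    apply hcirc.1
    refine ⟨Finset.Icc 1 (2 * r) \ (insert x (B.erase i)), Finset.mem_image_of_mem _ ?_, ?_⟩
    · rw [mem_catB]
      refine ⟨?_, ?_, ?_⟩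
      · intro y hy
        rcases Finset.mem_insert.1 hy with rfl | hy
        · exact Finset.mem_Icc.2 ⟨hx.1.1, by omega⟩
        · exact hB'.1 (Finset.mem_of_mem_erase hy)
      · rw [card_swap B i x hiB hx.2]; exact hB'.2.1
      · intro k
        have h1 := cnt_swap B i x k hiB hx.2
        have h2 := hD k
        have h3 := hD i
        by_cases hk : x ≤ k ∧ k < i
        · have h4 := cnt_run B k (i - k) (by
            intro j hj1 hj2
            by_contra hjB
            have := hxmax j ⟨⟨by omega, by omega⟩, hjB⟩
            omega)
          rw [show k + (i - k) = i by omega] at h4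
          rw [if_neg (by omega), if_pos (by omega)] at h1
          omega
        · split_ifs at h1 <;> omega
    · intro y hy
      have hyi := hmin y hy
      simp only [Finset.mem_sdiff, Finset.mem_insert, Finset.mem_erase]
      rcases Finset.mem_insert.1 (hC hy) with rfl | h
      · refine ⟨hi, ?_⟩
        rintro (h | h)
        · omega
        · exact h.1 rfl
      · have h' := Finset.mem_sdiff.1 h
        refine ⟨h'.1, ?_⟩
        rintro (h | h)
        · omega
        · exact h'.2 h.2

/-- Number of valleys at positions `3 ≤ i < m`. -/
def val (B : Finset ℕ) (m : ℕ) : ℕ :=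
  ((Finset.Ico 3 m).filter (fun i => i ∈ B ∧ i + 1 ∉ B)).card

lemma alphaStat_eq (r : ℕ) (hr : 2 ≤ r) (B : Finset ℕ) (hB : B ∈ catB r)
    (he : extAct (Finset.Icc 1 (2 * r)) (catB r) B = 1)
    (hi : intAct (Finset.Icc 1 (2 * r)) (catB r) B = 0) :
    alphaStat (Finset.Icc 1 (2 * r)) (catB r) B = val B (2 * r) := by
  have hB' := (mem_catB r B).1 hB
  have he' := (extAct_eq_one_iff r hr B hB).1 he
  have hi' := (intAct_eq_zero_iff r B hB).1 hi
  unfold alphaStat val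
  rw [he, hi]
  congr 1
  ext i
  simp only [Finset.mem_filter, Finset.mem_Ico]
  constructor
  · rintro ⟨hiB, hb, h1, h2⟩
    have hb' := (mem_catB r _).1 hb
    have hni : i + 1 ∉ B := by
      intro hin
      have hc := hb'.2.1
      rw [Finset.insert_eq_of_mem (by simp [hin])] at hc
      have := Finset.card_erase_add_one hiB
      have := hB'.2.1
      omega
    have h3 := (extAct_eq_one_iff r hr _ hb).1 h1
    have h4 := Finset.mem_Icc.1 (hb'.1 (Finset.mem_insert_self (i + 1) _))
    have h5 := Finset.mem_Icc.1 (hB'.1 hiB)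
    have h6 : i ≠ 1 := fun h => he'.1 (h ▸ hiB)
    have h7 : i ≠ 2 := by
      rintro rfl
      have := h3.2
      simp at this
    exact ⟨⟨by omega, by omega⟩, hiB, hni⟩
  · rintro ⟨⟨h3, h4⟩, hiB, hni⟩
    have hD : ∀ k, 2 * cnt (insert (i + 1) (B.erase i)) k ≤ k := by
      intro k
      have h1 := cnt_swap B i (i + 1) k hiB hni
      have h2 := hi' k
      split_ifs at h1 <;> omega
    have hb : insert (i + 1) (B.erase i) ∈ catB r := by
      rw [mem_catB]
      refine ⟨?_, ?_, ?_⟩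
      · intro y hy
        rcases Finset.mem_insert.1 hy with rfl | hy
        · exact Finset.mem_Icc.2 ⟨by omega, by omega⟩
        · exact hB'.1 (Finset.mem_of_mem_erase hy)
      · rw [card_swap B i (i + 1) hiB hni]; exact hB'.2.1
      · intro k
        have := hD k
        omega
    refine ⟨hiB, hb, ?_, ?_⟩
    · rw [extAct_eq_one_iff r hr _ hb]
      simp only [Finset.mem_insert, Finset.mem_erase]
      refine ⟨?_, Or.inr ⟨by omega, he'.2⟩⟩
      rintro (h | h)
      · omega
      · exact he'.1 h.2
    · rw [intAct_eq_zero_iff r _ hb]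
      exact hD

/-- Dyck-type subsets of `[m]` with `y` elements and `k` valleys. -/
noncomputable def Dk (m y k : ℕ) : Finset (Finset ℕ) :=
  (Finset.Icc 1 m).powerset.filter
    (fun B => B.card = y ∧ (∀ j, 2 * cnt B j ≤ j) ∧ 2 ∈ B ∧ val B m = k)

lemma mem_Dk (m y k : ℕ) (B : Finset ℕ) : B ∈ Dk m y k ↔
    B ⊆ Finset.Icc 1 m ∧ B.card = y ∧ (∀ j, 2 * cnt B j ≤ j) ∧ 2 ∈ B ∧ val B m = k := by
  unfold Dk
  rw [Finset.mem_filter, Finset.mem_powerset]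

noncomputable def DE (m y k : ℕ) : Finset (Finset ℕ) := (Dk m y k).filter (fun B => m ∉ B)
noncomputable def DN (m y k : ℕ) : Finset (Finset ℕ) := (Dk m y k).filter (fun B => m ∈ B)

lemma mem_DE (m y k : ℕ) (B : Finset ℕ) : B ∈ DE m y k ↔ B ∈ Dk m y k ∧ m ∉ B := by
  unfold DE
  rw [Finset.mem_filter]

lemma mem_DN (m y k : ℕ) (B : Finset ℕ) : B ∈ DN m y k ↔ B ∈ Dk m y k ∧ m ∈ B := by
  unfold DN
  rw [Finset.mem_filter]

lemma card_Dk (m y k : ℕ) : (Dk m y k).card = (DE m y k).card + (DN m y k).card := by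
  have := Finset.card_filter_add_card_filter_not (s := Dk m y k) (fun B => m ∈ B)
  unfold DE DN
  omega

lemma val_succ (B : Finset ℕ) (m : ℕ) (hm : 3 ≤ m) :
    val B (m + 1) = val B m + (if m ∈ B ∧ m + 1 ∉ B then 1 else 0) := by
  unfold val
  rw [← Finset.insert_Ico_right_eq_Ico_add_one hm, Finset.filter_insert]
  split_ifs with h
  · rw [Finset.card_insert_of_notMem]; simp
  · rfl

lemma val_insert (B : Finset ℕ) (m : ℕ) : val (insert (m + 1) B) m = val B m := by
  unfold val
  congr 1
  apply Finset.filter_congr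
  intro i hi
  have := Finset.mem_Ico.1 hi
  simp only [Finset.mem_insert]
  have h1 : ¬ i = m + 1 := by omega
  have h2 : ¬ i + 1 = m + 1 := by omega
  simp only [h1, h2, false_or]

lemma sub_succ {m : ℕ} {B : Finset ℕ} (h : m + 1 ∉ B) :
    B ⊆ Finset.Icc 1 (m + 1) ↔ B ⊆ Finset.Icc 1 m := by
  constructor
  · intro hs x hx
    have h1 := Finset.mem_Icc.1 (hs hx)
    have : x ≠ m + 1 := fun e => h (e ▸ hx)
    exact Finset.mem_Icc.2 ⟨h1.1, by omega⟩
  · intro hs x hx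
    have h1 := Finset.mem_Icc.1 (hs hx)
    exact Finset.mem_Icc.2 ⟨h1.1, by omega⟩

lemma notMem_succ {m : ℕ} {B : Finset ℕ} (h : B ⊆ Finset.Icc 1 m) : m + 1 ∉ B := by
  intro h1
  have := Finset.mem_Icc.1 (h h1)
  omega

lemma DE_zero (m y : ℕ) (hm : 3 ≤ m) : DE (m + 1) y 0 = DE m y 0 := by
  ext B
  simp only [mem_DE, mem_Dk]
  have hv := val_succ B m hm
  constructor
  · rintro ⟨⟨h1, h2, h3, h4, h5⟩, h6⟩
    rw [sub_succ h6] at h1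
    have hmB : m ∉ B := by
      intro hmB
      rw [if_pos ⟨hmB, h6⟩] at hv
      omega
    exact ⟨⟨h1, h2, h3, h4, by omega⟩, hmB⟩
  · rintro ⟨⟨h1, h2, h3, h4, h5⟩, h6⟩
    have h7 := notMem_succ h1
    rw [← sub_succ h7] at h1
    rw [if_neg (by tauto)] at hv
    exact ⟨⟨h1, h2, h3, h4, by omega⟩, h7⟩

lemma DE_succ (m y k : ℕ) (hm : 3 ≤ m) :
    (DE (m + 1) y (k + 1)).card = (DE m y (k + 1)).card + (DN m y k).card := by
  rw [← Finset.card_union_of_disjoint]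
  · congr 1
    ext B
    simp only [Finset.mem_union, mem_DE, mem_DN, mem_Dk]
    have hv := val_succ B m hm
    constructor
    · rintro ⟨⟨h1, h2, h3, h4, h5⟩, h6⟩
      rw [sub_succ h6] at h1
      by_cases hmB : m ∈ B
      · rw [if_pos ⟨hmB, h6⟩] at hv
        exact Or.inr ⟨⟨h1, h2, h3, h4, by omega⟩, hmB⟩
      · rw [if_neg (by tauto)] at hv
        exact Or.inl ⟨⟨h1, h2, h3, h4, by omega⟩, hmB⟩
    · rintro (⟨⟨h1, h2, h3, h4, h5⟩, h6⟩ | ⟨⟨h1, h2, h3, h4, h5⟩, h6⟩)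
      · have h7 := notMem_succ h1
        rw [← sub_succ h7] at h1
        rw [if_neg (by tauto)] at hv
        exact ⟨⟨h1, h2, h3, h4, by omega⟩, h7⟩
      · have h7 := notMem_succ h1
        rw [← sub_succ h7] at h1
        rw [if_pos ⟨h6, h7⟩] at hv
        exact ⟨⟨h1, h2, h3, h4, by omega⟩, h7⟩
  · rw [Finset.disjoint_left]
    intro B h1 h2
    exact ((mem_DE _ _ _ _).1 h1).2 ((mem_DN _ _ _ _).1 h2).2

lemma cnt_le_card (B : Finset ℕ) (j : ℕ) : cnt B j ≤ B.card :=
  Finset.card_le_card (Finset.filter_subset _ _)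

lemma DN_succ (m y k : ℕ) (hm : 3 ≤ m) (hy : 2 * (y + 1) ≤ m + 1) :
    (DN (m + 1) (y + 1) k).card = (DE m y k).card + (DN m y k).card := by
  rw [← card_Dk]
  symm
  apply Finset.card_bij (fun B _ => insert (m + 1) B)
  · intro B hB
    obtain ⟨h1, h2, h3, h4, h5⟩ := (mem_Dk _ _ _ _).1 hB
    have h7 := notMem_succ h1
    rw [mem_DN, mem_Dk]
    refine ⟨⟨?_, ?_, ?_, ?_, ?_⟩, by simp⟩
    · intro x hx
      rcases Finset.mem_insert.1 hx with rfl | hx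
      · simp
      · exact (sub_succ h7).2 h1 hx
    · rw [Finset.card_insert_of_notMem h7, h2]
    · intro j
      rw [cnt_insert _ _ _ h7]
      have := h3 j
      have := cnt_le_card B j
      split_ifs <;> omega
    · simp [h4]
    · rw [val_succ _ _ hm, val_insert, if_neg (by simp)]
      omega
  · intro B1 hB1 B2 hB2 h
    have h1 := notMem_succ ((mem_Dk _ _ _ _).1 hB1).1
    have h2 := notMem_succ ((mem_Dk _ _ _ _).1 hB2).1
    rw [← Finset.erase_insert h1, ← Finset.erase_insert h2, h]
  · intro B hB
    rw [mem_DN, mem_Dk] at hB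
    obtain ⟨⟨h1, h2, h3, h4, h5⟩, h6⟩ := hB
    have hins := Finset.insert_erase h6
    refine ⟨B.erase (m + 1), ?_, hins⟩
    rw [mem_Dk]
    refine ⟨?_, ?_, ?_, ?_, ?_⟩
    · apply (sub_succ (by simp)).1
      exact (Finset.erase_subset _ _).trans h1
    · rw [Finset.card_erase_of_mem h6, h2]; rfl
    · intro j
      have := cnt_erase B (m + 1) j h6
      have := h3 j
      omega
    · simp only [Finset.mem_erase]
      exact ⟨by omega, h4⟩
    · rw [← val_insert, hins]
      rw [val_succ _ _ hm, if_neg (by tauto)] at h5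
      omega

/-- Number of compositions of `n` into `k` parts. -/
def bb : ℕ → ℕ → ℤ
  | 0, 0 => 1
  | 0, _ + 1 => 0
  | _ + 1, 0 => 0
  | n + 1, k + 1 => (Nat.choose n k : ℤ)

lemma bb_pascal (n k : ℕ) : bb (n + 1) (k + 1) = bb n k + bb n (k + 1) := by
  cases n with
  | zero => cases k <;> simp [bb]
  | succ n =>
    cases k with
    | zero => simp [bb]
    | succ k => simp [bb, Nat.choose_succ_succ]

lemma bb_zero_right (n : ℕ) (hn : 1 ≤ n) : bb n 0 = 0 := by
  cases n with
  | zero => omega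
  | succ n => rfl

lemma bb_one (n : ℕ) (hn : 1 ≤ n) : bb n 1 = 1 := by
  cases n with
  | zero => omega
  | succ n => simp [bb]

lemma Dk_base (k : ℕ) : ((DE 3 1 k).card : ℤ) = bb 1 (k + 1) * bb 0 k - bb 1 k * bb 0 (k + 1)
    ∧ (DN 3 1 k).card = 0 := by
  have hval : ∀ B, val B 3 = 0 := by intro B; simp [val]
  have hB : ∀ B, B ∈ Dk 3 1 k → B = {2} ∧ k = 0 := by
    intro B hB
    obtain ⟨h1, h2, h3, h4, h5⟩ := (mem_Dk _ _ _ _).1 hB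
    rw [hval] at h5
    obtain ⟨a, rfl⟩ := Finset.card_eq_one.1 h2
    rw [Finset.mem_singleton] at h4
    exact ⟨by rw [h4], h5.symm⟩
  constructor
  · cases k with
    | zero =>
      have : DE 3 1 0 = {{2}} := by
        ext B
        rw [mem_DE, Finset.mem_singleton]
        constructor
        · rintro ⟨h, -⟩
          exact (hB B h).1
        · rintro rfl
          rw [mem_Dk]
          refine ⟨⟨by simp, by simp, ?_, by simp, hval _⟩, by simp⟩
          intro j
          unfold cnt
          rw [Finset.filter_singleton]
          split_ifs with h
          · simpa using h
          · simp
      rw [this]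
      simp [bb]
    | succ k =>
      have : DE 3 1 (k + 1) = ∅ := by
        apply Finset.eq_empty_of_forall_notMem
        intro B h
        have := (hB B ((mem_DE _ _ _ _).1 h).1).2
        omega
      rw [this]
      simp [bb]
  · rw [Finset.card_eq_zero]
    apply Finset.eq_empty_of_forall_notMem
    intro B h
    have h' := (mem_DN _ _ _ _).1 h
    have := (hB B h'.1).1
    rw [this] at h'
    simp at h'

lemma Dk_empty (m y k : ℕ) (h : m < 2 * y) : Dk m y k = ∅ := by
  apply Finset.eq_empty_of_forall_notMem
  intro B hB
  obtain ⟨h1, h2, h3, h4, h5⟩ := (mem_Dk _ _ _ _).1 hB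
  have := h3 m
  have hc : cnt B m = B.card := by
    unfold cnt
    rw [Finset.filter_true_of_mem]
    intro x hx
    exact (Finset.mem_Icc.1 (h1 hx)).2
  omega

lemma main_count (m : ℕ) (hm : 3 ≤ m) : ∀ x y k : ℕ, x + y + 2 = m → y ≤ x →
    ((DE m (y + 1) k).card : ℤ) = bb x (k + 1) * bb y k - bb x k * bb y (k + 1) ∧
    ((DN m (y + 1) k).card : ℤ) = bb x (k + 1) * bb y (k + 1) - bb x k * bb y (k + 2) := by
  induction m, hm using Nat.le_induction with
  | base =>
    intro x y k h1 h2
    obtain rfl : y = 0 := by omega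
    obtain rfl : x = 1 := by omega
    have := Dk_base k
    refine ⟨this.1, ?_⟩
    rw [show (0 : ℕ) + 1 = 1 from rfl, this.2]
    simp [bb]
  | succ m hm ih =>
    intro x y k h1 h2
    constructor
    · by_cases hxy : y = x
      · subst hxy
        have hE : ∀ k, Dk m (y + 1) k = ∅ := fun k => Dk_empty _ _ _ (by omega)
        have hE1 : ∀ k, (DE m (y + 1) k).card = 0 := by intro k; simp [DE, hE]
        have hN1 : ∀ k, (DN m (y + 1) k).card = 0 := by intro k; simp [DN, hE]
        cases k with
        | zero => rw [DE_zero m _ hm, hE1]; push_cast; ring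
        | succ k => rw [DE_succ m _ _ hm, hE1, hN1]; push_cast; ring
      · obtain ⟨x, rfl⟩ : ∃ x', x = x' + 1 := ⟨x - 1, by omega⟩
        have hx1 : 1 ≤ x := by omega
        cases k with
        | zero =>
          rw [DE_zero m _ hm, (ih x y 0 (by omega) (by omega)).1,
            bb_zero_right x hx1, bb_zero_right (x + 1) (by omega), bb_one x hx1,
            bb_one (x + 1) (by omega)]
        | succ k =>
          rw [DE_succ m _ _ hm]
          push_cast
          rw [(ih x y (k + 1) (by omega) (by omega)).1, (ih x y k (by omega) (by omega)).2,
            bb_pascal x (k + 1), bb_pascal x k]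
          ring
    · cases y with
      | zero =>
        have : DN (m + 1) (0 + 1) k = ∅ := by
          apply Finset.eq_empty_of_forall_notMem
          intro B hB
          obtain ⟨h3, h4⟩ := (mem_DN _ _ _ _).1 hB
          obtain ⟨-, h5, -, h6, -⟩ := (mem_Dk _ _ _ _).1 h3
          obtain ⟨a, rfl⟩ := Finset.card_eq_one.1 h5
          rw [Finset.mem_singleton] at h4 h6
          omega
        rw [this]
        simp [bb]
      | succ y =>
        rw [DN_succ m _ _ hm (by omega)]
        push_cast
        rw [(ih x y k (by omega) (by omega)).1, (ih x y k (by omega) (by omega)).2,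
          bb_pascal y k, bb_pascal y (k + 1)]
        ring

lemma narayana_id (p k : ℕ) :
    ((p : ℤ) + 1) * (bb (p + 1) (k + 1) * bb (p + 1) (k + 1) - bb (p + 1) k * bb (p + 1) (k + 2))
      = (Nat.choose (p + 1) k : ℤ) * (Nat.choose (p + 1) (k + 1) : ℤ) := by
  cases k with
  | zero => simp [bb]
  | succ k =>
    simp only [bb]
    have h1 := Nat.choose_succ_right_eq p k
    have h2 := Nat.choose_succ_right_eq p (k + 1)
    rw [Nat.choose_succ_succ p k, Nat.choose_succ_succ p (k + 1)]
    by_cases hk : k + 1 ≤ p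
    · obtain ⟨q, rfl⟩ := Nat.exists_eq_add_of_le hk
      rw [show k + 1 + q - k = q + 1 by omega] at h1
      rw [show k + 1 + q - (k + 1) = q by omega] at h2
      simp only [Nat.succ_eq_add_one]
      generalize Nat.choose (k + 1 + q) k = a at *
      generalize Nat.choose (k + 1 + q) (k + 1) = b at *
      generalize Nat.choose (k + 1 + q) (k + 1 + 1) = c at *
      zify at h1 h2
      push_cast
      linear_combination (b + c : ℤ) * h1 - (a + b : ℤ) * h2
    · have e1 : Nat.choose p (k + 1) = 0 := Nat.choose_eq_zero_of_lt (by omega)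
      have e2 : Nat.choose p (k + 1 + 1) = 0 := Nat.choose_eq_zero_of_lt (by omega)
      simp [e1, e2]

lemma card_Dk_final (p k : ℕ) :
    (((Dk (2 * (p + 2)) (p + 2) k).card : ℕ) : ℚ)
      = (1 / ((p : ℚ) + 1)) * (Nat.choose (p + 1) k : ℚ) * (Nat.choose (p + 1) (k + 1) : ℚ) := by
  have h := main_count (2 * (p + 2)) (by omega) (p + 1) (p + 1) k (by omega) le_rfl
  have h2 : ((Dk (2 * (p + 2)) (p + 2) k).card : ℤ)
      = bb (p + 1) (k + 1) * bb (p + 1) (k + 1) - bb (p + 1) k * bb (p + 1) (k + 2) := by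
    rw [card_Dk]
    push_cast
    rw [h.1, h.2]
    ring
  have h3 := narayana_id p k
  rw [← h2] at h3
  have h4 : ((p : ℚ) + 1) * ((Dk (2 * (p + 2)) (p + 2) k).card : ℚ)
      = (Nat.choose (p + 1) k : ℚ) * (Nat.choose (p + 1) (k + 1) : ℚ) := by exact_mod_cast h3
  have h5 : (p : ℚ) + 1 ≠ 0 := by positivity
  field_simp
  linarith

/-- For `r ≥ 2` and the Catalan matroid
`Cat_r = SM({1, 3, …, 2r−1})` on `[2r]`, in `ℚ[t]`:
`Σ_{B basis, e(B)=1, i(B)=0} t^{α(B)}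
  = Σ_{k=0}^{r−2} (1/(r−1)) C(r−1, k) C(r−1, k+1) t^k` (the Narayana polynomial). -/
theorem statement13 (r : ℕ) (hr : 2 ≤ r) :
    ∑ B ∈ (schubertBases (2 * r) r ((Finset.range r).image fun k => 2 * k + 1)).filter
        (fun B =>
          extAct (Finset.Icc 1 (2 * r))
            (schubertBases (2 * r) r ((Finset.range r).image fun k => 2 * k + 1)) B = 1 ∧
          intAct (Finset.Icc 1 (2 * r))
            (schubertBases (2 * r) r ((Finset.range r).image fun k => 2 * k + 1)) B = 0),
      ((Polynomial.X : Polynomial ℚ) ^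
        alphaStat (Finset.Icc 1 (2 * r))
          (schubertBases (2 * r) r ((Finset.range r).image fun k => 2 * k + 1)) B)
      = ∑ k ∈ Finset.range (r - 1),
          Polynomial.C ((1 / (r - 1 : ℚ)) * (Nat.choose (r - 1) k : ℚ) *
              (Nat.choose (r - 1) (k + 1) : ℚ)) *
            (Polynomial.X : Polynomial ℚ) ^ k := by
  have hsum : ∀ B ∈ (catB r).filter (fun B =>
      extAct (Finset.Icc 1 (2 * r)) (catB r) B = 1 ∧
      intAct (Finset.Icc 1 (2 * r)) (catB r) B = 0),
      ((Polynomial.X : Polynomial ℚ) ^ alphaStat (Finset.Icc 1 (2 * r)) (catB r) B)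
        = Polynomial.X ^ val B (2 * r) := by
    intro B hB
    obtain ⟨h1, h2, h3⟩ := Finset.mem_filter.1 hB
    rw [alphaStat_eq r hr B h1 h2 h3]
  refine (Finset.sum_congr rfl hsum).trans ?_
  obtain ⟨p, rfl⟩ : ∃ p, r = p + 2 := ⟨r - 2, by omega⟩
  ext k
  rw [Polynomial.finsetSum_coeff, Polynomial.finsetSum_coeff]
  simp only [Polynomial.coeff_X_pow, Polynomial.coeff_C_mul]
  have hR : ∀ f : ℕ → ℚ, (∑ j ∈ Finset.range (p + 2 - 1), f j * (if k = j then 1 else 0))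
      = if k < p + 1 then f k else 0 := by
    intro f
    simp
  rw [hR, Finset.sum_boole, Finset.filter_filter]
  have hset : (catB (p + 2)).filter (fun B =>
      (extAct (Finset.Icc 1 (2 * (p + 2))) (catB (p + 2)) B = 1 ∧
      intAct (Finset.Icc 1 (2 * (p + 2))) (catB (p + 2)) B = 0) ∧ k = val B (2 * (p + 2)))
      = Dk (2 * (p + 2)) (p + 2) k := by
    ext B
    rw [Finset.mem_filter, mem_Dk]
    constructor
    · rintro ⟨hB, ⟨h1, h2⟩, h3⟩
      have hB' := (mem_catB _ B).1 hB
      exact ⟨hB'.1, hB'.2.1, (intAct_eq_zero_iff _ B hB).1 h2,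
        ((extAct_eq_one_iff _ hr B hB).1 h1).2, h3.symm⟩
    · rintro ⟨h1, h2, h3, h4, h5⟩
      have hB : B ∈ catB (p + 2) := by
        rw [mem_catB]
        exact ⟨h1, h2, fun j => (h3 j).trans (Nat.le_succ j)⟩
      refine ⟨hB, ⟨(extAct_eq_one_iff _ hr B hB).2 ⟨?_, h4⟩,
        (intAct_eq_zero_iff _ B hB).2 h3⟩, h5.symm⟩
      intro h
      have := h3 1
      have hp : 0 < cnt B 1 := Finset.card_pos.2 ⟨1, by simp [h]⟩
      omega
  rw [hset, card_Dk_final]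
  have e1 : ((p + 2 : ℕ) : ℚ) - 1 = (p : ℚ) + 1 := by push_cast; ring
  rw [e1, show p + 2 - 1 = p + 1 from rfl]
  split_ifs with hk
  · rfl
  · rw [Nat.choose_eq_zero_of_lt (show p + 1 < k + 1 by omega)]
    simp
end GPoly
end
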